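/- arXiv:2411.01002 — 2 statements merged into one kernel-verified Lean document; each statement's English description precedes it below -/
import Mathlib

section
/- Stability of the Ising model on an arbitrary graph under symmetric perturbations with connected supports (spectral part): Fix an integer Δ_G ≥ 2 and a real κ₁ > 0. There exist positive constants ε₀, c₁, c₂, c₃ depending only on Δ_G and κ₁ such that the following holds. Let G be a connected graph on n ≥ c₃ vertices with maximum degree at most Δ_G, and let H₀ = Σ_{(i,j) ∈ E(G)} (I − P(0, eᵢ + eⱼ))/2 be the Ising Hamiltonian on n qubits (checks are the two-body operators Zᵢ Zⱼ over edges of G). Let V be a Hermitian 2ⁿ×2ⁿ matrix presented as V = Σ_{S,s} V_{S,s}, where every S is a connected subset of vertices of G, each V_{S,s} is strongly supported in S with syndrome s and commutes with the global spin-flip matrix P(1ⁿ, 0) (the all-ones X string), and ε := ‖V‖_{κ₁} ≤ min(ε₀, 1/(3c₁)). Set ε_* := c₂·n·ε·exp(−κ₁·n/2). Then there exists a real number c_* such that every eigenvalue of H₀ + V − c_*·I lies in [−ε_*, ε_*] ∪ [1/2 + ε_*, ∞), and exactly 2 eigenvalues, counted with multiplicity, lie in [−ε_*, ε_*]. -/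
open Classical

noncomputable section

/-- Vectors over `F₂` indexed by the `n` qubits. -/
abbrev F2vec (n : ℕ) := Fin n → ZMod 2

/-- Support of a Pauli operator `(x, z)` on `n` qubits. -/
def pSupp {n : ℕ} (p : F2vec n × F2vec n) : Finset (Fin n) :=
  Finset.univ.filter fun i => p.1 i ≠ 0 ∨ p.2 i ≠ 0

/-- Symplectic form deciding (anti)commutation of two Pauli operators. -/
def sympl {n : ℕ} (p q : F2vec n × F2vec n) : ZMod 2 :=
  ∑ i, (p.1 i * q.2 i + q.1 i * p.2 i)

/-- The (Hermitian unitary) Pauli matrix of `(x, z)`, acting on `ℂ^(2^n)` with basis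
indexed by `F₂ⁿ`. -/
def pauli {n : ℕ} (p : F2vec n × F2vec n) : Matrix (F2vec n) (F2vec n) ℂ :=
  fun a b =>
    if a = b + p.1 then
      Complex.I ^ (Finset.univ.filter fun i => p.1 i = 1 ∧ p.2 i = 1).card *
        (-1 : ℂ) ^ (∑ i, (p.2 i).val * (b i).val)
    else 0

/-- The `ℓ² → ℓ²` operator norm of a matrix acting on the `n`-qubit Hilbert space. -/
def opNorm {n : ℕ} (M : Matrix (F2vec n) (F2vec n) ℂ) : ℝ :=
  ‖Matrix.toEuclideanCLM (𝕜 := ℂ) M‖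

/-- The `F₂`-vector supported on the two endpoints of the edge `e`; the Ising check of
`e` is the Z-type Pauli operator `(0, isingVec e)`, i.e. `Zᵢ Zⱼ` for `e = (i, j)`. -/
def isingVec {n : ℕ} (e : Sym2 (Fin n)) : F2vec n :=
  fun i => if i ∈ e then 1 else 0

/-- The syndrome of a Pauli operator for the Ising model on `G`: the set of edges whose
checks `Zᵢ Zⱼ` anticommute with it. -/
def isingSyndrome {n : ℕ} (G : SimpleGraph (Fin n)) [DecidableRel G.Adj]
    (p : F2vec n × F2vec n) : Finset (Sym2 (Fin n)) :=
  G.edgeFinset.filter fun e => sympl p ((0 : F2vec n), isingVec e) = 1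

/-- A matrix is strongly supported in `S` with syndrome `s` (for the Ising model on
`G`): it is a `ℂ`-linear combination of Pauli matrices with support inside `S` and
syndrome `s`, and every check (edge) in `s` has support inside `S`. -/
def IsingStronglySupported {n : ℕ} (G : SimpleGraph (Fin n)) [DecidableRel G.Adj]
    (M : Matrix (F2vec n) (F2vec n) ℂ) (S : Finset (Fin n)) (s : Finset (Sym2 (Fin n))) :
    Prop :=
  M ∈ Submodule.span ℂ
      {A : Matrix (F2vec n) (F2vec n) ℂ |
        ∃ p : F2vec n × F2vec n, A = pauli p ∧ pSupp p ⊆ S ∧ isingSyndrome G p = s} ∧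
    ∀ e ∈ s, pSupp ((0 : F2vec n), isingVec e) ⊆ S

/-- The `κ`-norm (local strength) of a presentation `S, s ↦ V_{S,s}`:
`max_i Σ_{S ∋ i} Σ_s ‖V_{S,s}‖·e^{κ|S|}`. -/
def isingKappaNorm {n : ℕ}
    (VF : Finset (Fin n) → Finset (Sym2 (Fin n)) → Matrix (F2vec n) (F2vec n) ℂ)
    (κ : ℝ) : ℝ :=
  ⨆ i : Fin n, ∑ S ∈ Finset.univ.filter (fun S : Finset (Fin n) => i ∈ S),
    ∑ s : Finset (Sym2 (Fin n)), opNorm (VF S s) * Real.exp (κ * S.card)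

/-! ### Weighted column bounds -/

section

attribute [local instance] Matrix.linftyOpNormedRing Matrix.linftyOpNormedAlgebra

theorem Matrix.hasSum_exp {Γ : Type*} [Fintype Γ] [DecidableEq Γ] (B : Matrix Γ Γ ℂ) :
    HasSum (fun k : ℕ => ((k.factorial : ℂ)⁻¹) • B ^ k) (NormedSpace.exp B) :=
  NormedSpace.exp_series_hasSum_exp' (𝕂 := ℂ) B

theorem Real.hasSum_exp_series (q : ℝ) :
    HasSum (fun k : ℕ => ((k.factorial : ℝ)⁻¹) * q ^ k) (Real.exp q) := by
  rw [Real.exp_eq_exp_ℝ]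
  simpa using NormedSpace.exp_series_hasSum_exp' (𝕂 := ℝ) q

end

/-- Every column of `M`, weighted by a function `w` of the displacement, has `ℓ¹` norm at
most `C`. -/
def ColBound {Γ : Type*} [AddCommGroup Γ] [Fintype Γ] (w : Γ → ℝ) (M : Matrix Γ Γ ℂ)
    (C : ℝ) : Prop :=
  ∀ b, ∑ a, ‖M a b‖ * w (a - b) ≤ C

namespace ColBound

variable {Γ : Type*} [AddCommGroup Γ] [Fintype Γ] {u w : Γ → ℝ} {M N B : Matrix Γ Γ ℂ}
  {C D C' D' p q : ℝ}

theorem mono (h : ColBound w M C) (hCD : C ≤ D) : ColBound w M D :=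
  fun b => (h b).trans hCD

theorem zero : ColBound w (0 : Matrix Γ Γ ℂ) 0 := fun b => by simp

theorem nonneg (hw : ∀ x, 0 ≤ w x) (h : ColBound w M C) : 0 ≤ C :=
  (Finset.sum_nonneg fun _ _ => mul_nonneg (norm_nonneg _) (hw _)).trans (h 0)

theorem add (hw : ∀ x, 0 ≤ w x) (hM : ColBound w M C) (hN : ColBound w N D) :
    ColBound w (M + N) (C + D) := fun b => by
  refine le_trans ?_ (add_le_add (hM b) (hN b))
  rw [← Finset.sum_add_distrib]
  refine Finset.sum_le_sum fun a _ => ?_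
  rw [← add_mul]
  exact mul_le_mul_of_nonneg_right (norm_add_le _ _) (hw _)

theorem sum (hw : ∀ x, 0 ≤ w x) {ι : Type*} (s : Finset ι) {F : ι → Matrix Γ Γ ℂ}
    {K : ι → ℝ} (h : ∀ i ∈ s, ColBound w (F i) (K i)) :
    ColBound w (∑ i ∈ s, F i) (∑ i ∈ s, K i) := by
  induction s using Finset.induction_on with
  | empty => simpa using zero
  | insert i s hi ih =>
    rw [Finset.sum_insert hi, Finset.sum_insert hi]
    exact (h i (Finset.mem_insert_self i s)).add hw
      (ih fun j hj => h j (Finset.mem_insert_of_mem hj))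

theorem smul (c : ℂ) (hM : ColBound w M C) : ColBound w (c • M) (‖c‖ * C) := fun b => by
  have : ∑ a, ‖(c • M) a b‖ * w (a - b) = ‖c‖ * ∑ a, ‖M a b‖ * w (a - b) := by
    rw [Finset.mul_sum]
    exact Finset.sum_congr rfl fun a _ => by simp [mul_assoc]
  rw [this]
  exact mul_le_mul_of_nonneg_left (hM b) (norm_nonneg _)

theorem neg (hM : ColBound w M C) : ColBound w (-M) C := fun b => by simpa using hM b

/-- Multiplying the rows by factors of modulus at most one preserves column bounds. -/
theorem diagonal_mul [DecidableEq Γ] (hw : ∀ x, 0 ≤ w x) {d : Γ → ℂ} (hd : ∀ a, ‖d a‖ ≤ 1)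
    (hM : ColBound w M C) : ColBound w (Matrix.diagonal d * M) C := fun b => by
  refine (Finset.sum_le_sum fun a _ => ?_).trans (hM b)
  rw [Matrix.diagonal_mul, norm_mul]
  exact mul_le_mul_of_nonneg_right
    (mul_le_of_le_one_left (norm_nonneg _) (hd a)) (hw _)

theorem circulant (v : Γ → ℂ) :
    ColBound w (Matrix.circulant v) (∑ x, ‖v x‖ * w x) := fun b => by
  simp only [Matrix.circulant_apply]
  exact (Equiv.sum_comp (Equiv.subRight b) fun x => ‖v x‖ * w x).le

/-- Column bounds of a product, for weights satisfying a Leibniz-type inequality. -/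
theorem mul_of_le {w₁ w₂ w₃ w₄ : Γ → ℝ} (hw : ∀ x, 0 ≤ w x) (h₂ : ∀ x, 0 ≤ w₂ x)
    (h₄ : ∀ x, 0 ≤ w₄ x)
    (hle : ∀ x y, w (x + y) ≤ w₁ x * w₂ y + w₃ x * w₄ y)
    (hM₁ : ColBound w₁ M C) (hN₂ : ColBound w₂ N D) (hM₃ : ColBound w₃ M C')
    (hN₄ : ColBound w₄ N D') (hC : 0 ≤ C) (hC' : 0 ≤ C') :
    ColBound w (M * N) (C * D + C' * D') := fun b => by
  calc ∑ a, ‖(M * N) a b‖ * w (a - b)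
      ≤ ∑ a, ∑ k, (‖N k b‖ * w₂ (k - b) * (‖M a k‖ * w₁ (a - k)) +
          ‖N k b‖ * w₄ (k - b) * (‖M a k‖ * w₃ (a - k))) := by
        refine Finset.sum_le_sum fun a _ => ?_
        calc ‖(M * N) a b‖ * w (a - b)
            ≤ (∑ k, ‖M a k‖ * ‖N k b‖) * w (a - b) := by
              refine mul_le_mul_of_nonneg_right ?_ (hw _)
              rw [Matrix.mul_apply]
              exact (norm_sum_le _ _).trans_eq (by simp)
          _ = ∑ k, ‖M a k‖ * ‖N k b‖ * w ((a - k) + (k - b)) := by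
              rw [Finset.sum_mul]
              simp
          _ ≤ _ := by
              refine Finset.sum_le_sum fun k _ => ?_
              refine (mul_le_mul_of_nonneg_left (hle (a - k) (k - b)) (by positivity)).trans_eq ?_
              ring
    _ = ∑ k, (‖N k b‖ * w₂ (k - b) * ∑ a, ‖M a k‖ * w₁ (a - k)) +
          ∑ k, (‖N k b‖ * w₄ (k - b) * ∑ a, ‖M a k‖ * w₃ (a - k)) := by
        rw [Finset.sum_comm, ← Finset.sum_add_distrib]
        exact Finset.sum_congr rfl fun k _ => by
          rw [Finset.sum_add_distrib, Finset.mul_sum, Finset.mul_sum]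
    _ ≤ ∑ k, (‖N k b‖ * w₂ (k - b) * C) + ∑ k, (‖N k b‖ * w₄ (k - b) * C') := by
        gcongr with k _ k _
        · exact mul_nonneg (norm_nonneg _) (h₂ _)
        · exact hM₁ k
        · exact mul_nonneg (norm_nonneg _) (h₄ _)
        · exact hM₃ k
    _ ≤ C * D + C' * D' := by
        rw [← Finset.sum_mul, ← Finset.sum_mul, mul_comm C, mul_comm C']
        gcongr
        · exact hN₂ b
        · exact hN₄ b

theorem mul (hw : ∀ x, 0 ≤ w x) (hsub : ∀ x y, w (x + y) ≤ w x * w y)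
    (hM : ColBound w M C) (hN : ColBound w N D) : ColBound w (M * N) (C * D) := by
  have h0 : ∀ K : Matrix Γ Γ ℂ, ColBound (fun _ : Γ => (0 : ℝ)) K 0 := fun K b => by simp
  simpa using mul_of_le (w₃ := fun _ => 0) (w₄ := fun _ => 0) hw hw (fun _ => le_rfl)
    (by simpa using hsub) hM hN (h0 M) (h0 N) (hM.nonneg hw) le_rfl

theorem mul_leibniz (hw : ∀ x, 0 ≤ w x) (hu : ∀ x, 0 ≤ u x)
    (hsub : ∀ x y, u (x + y) ≤ u x * w y + w x * u y)
    (hM : ColBound w M C) (hN : ColBound w N D) (hM' : ColBound u M C')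
    (hN' : ColBound u N D') : ColBound u (M * N) (C' * D + C * D') :=
  mul_of_le hu hw hu hsub hM' hN hM hN' (hM'.nonneg hu) (hM.nonneg hw)

section

variable [DecidableEq Γ]

theorem one : ColBound w (1 : Matrix Γ Γ ℂ) (w 0) := fun b => by
  rw [Finset.sum_eq_single b]
  · simp
  · intro a _ hab
    simp [Matrix.one_apply_ne hab]
  · simp

theorem pow (hw : ∀ x, 0 ≤ w x) (hw0 : w 0 = 1) (hsub : ∀ x y, w (x + y) ≤ w x * w y)
    (hB : ColBound w B q) (k : ℕ) : ColBound w (B ^ k) (q ^ k) := by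
  induction k with
  | zero => simpa [hw0] using one (w := w)
  | succ k ih => rw [pow_succ, pow_succ]; exact ih.mul hw hsub hB

theorem pow_leibniz (hw : ∀ x, 0 ≤ w x) (hw0 : w 0 = 1)
    (hsub : ∀ x y, w (x + y) ≤ w x * w y) (hu : ∀ x, 0 ≤ u x)
    (hsub' : ∀ x y, u (x + y) ≤ u x * w y + w x * u y)
    (hB : ColBound w B q) (hB' : ColBound u B p) (k : ℕ) :
    ColBound u (B ^ (k + 1)) ((k + 1) * q ^ k * p) := by
  induction k with
  | zero => simpa using hB'
  | succ k ih =>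
    rw [pow_succ]
    refine ((hB.pow hw hw0 hsub (k + 1)).mul_leibniz hw hu hsub' hB ih hB').mono (le_of_eq ?_)
    push_cast
    ring

end

/-- Column bounds pass to convergent series. -/
theorem of_hasSum (hw : ∀ x, 0 ≤ w x) {F : ℕ → Matrix Γ Γ ℂ} {K : ℕ → ℝ}
    (hF : HasSum F M) (hK : HasSum K C) (h : ∀ k, ColBound w (F k) (K k)) :
    ColBound w M C := fun b => by
  have hcont : Continuous fun M : Matrix Γ Γ ℂ => ∑ a, ‖M a b‖ * w (a - b) := by
    refine continuous_finsetSum _ fun a _ => ?_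
    exact ((continuous_id.matrix_elem a b).norm).mul continuous_const
  refine le_of_tendsto_of_tendsto' ((hcont.tendsto M).comp hF) hK fun s => ?_
  exact sum hw s (fun i _ => h i) b

section Exponential

variable [DecidableEq Γ]

theorem exp_sub_one (hw : ∀ x, 0 ≤ w x) (hw0 : w 0 = 1)
    (hsub : ∀ x y, w (x + y) ≤ w x * w y) (hB : ColBound w B q) :
    ColBound w (NormedSpace.exp B - 1) (Real.exp q - 1) := by
  have h1 := (hasSum_nat_add_iff' 1).2 (Matrix.hasSum_exp B)
  have h2 := (hasSum_nat_add_iff' 1).2 (Real.hasSum_exp_series q)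
  simp only [Finset.sum_range_one, Nat.factorial_zero, Nat.cast_one, inv_one, pow_zero,
    one_smul, mul_one] at h1 h2
  refine of_hasSum hw h1 h2 fun k => ((hB.pow hw hw0 hsub (k + 1)).smul _).mono (le_of_eq ?_)
  simp

theorem exp (hw : ∀ x, 0 ≤ w x) (hw0 : w 0 = 1)
    (hsub : ∀ x y, w (x + y) ≤ w x * w y) (hB : ColBound w B q) :
    ColBound w (NormedSpace.exp B) (Real.exp q) := by
  simpa [hw0] using (exp_sub_one hw hw0 hsub hB).add hw one

theorem exp_sub_one_sub (hw : ∀ x, 0 ≤ w x) (hw0 : w 0 = 1)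
    (hsub : ∀ x y, w (x + y) ≤ w x * w y) (hu : ∀ x, 0 ≤ u x)
    (hsub' : ∀ x y, u (x + y) ≤ u x * w y + w x * u y)
    (hB : ColBound w B q) (hB' : ColBound u B p) :
    ColBound u (NormedSpace.exp B - 1 - B) (p * (Real.exp q - 1)) := by
  have h1 := (hasSum_nat_add_iff' 2).2 (Matrix.hasSum_exp B)
  have h2 := ((hasSum_nat_add_iff' 1).2 (Real.hasSum_exp_series q)).mul_left p
  simp only [Finset.sum_range_succ, Finset.sum_range_zero, zero_add, Nat.factorial_zero,
    Nat.factorial_one, Nat.cast_one, inv_one, pow_zero, pow_one, one_smul, mul_one,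
    ← sub_sub] at h1 h2
  refine of_hasSum hu h1 h2 fun k =>
    ((hB.pow_leibniz hw hw0 hsub hu hsub' hB' (k + 1)).smul _).mono (le_of_eq ?_)
  rw [Nat.factorial_succ (k + 1)]
  have h3 : ((k + 1).factorial : ℝ) ≠ 0 := by positivity
  have h4 : ((k : ℝ) + 1 + 1) ≠ 0 := by positivity
  simp only [norm_inv, Complex.norm_natCast]
  push_cast
  field_simp

theorem exp_leibniz (hw : ∀ x, 0 ≤ w x) (hw0 : w 0 = 1)
    (hsub : ∀ x y, w (x + y) ≤ w x * w y) (hu : ∀ x, 0 ≤ u x) (hu0 : u 0 = 0)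
    (hsub' : ∀ x y, u (x + y) ≤ u x * w y + w x * u y)
    (hB : ColBound w B q) (hB' : ColBound u B p) :
    ColBound u (NormedSpace.exp B) (p * Real.exp q) := by
  have h := ((exp_sub_one_sub hw hw0 hsub hu hsub' hB hB').add hu hB').add hu one
  rw [sub_add_cancel, sub_add_cancel, hu0] at h
  exact h.mono (le_of_eq (by ring))

end Exponential

end ColBound

/-! ### A fixed point theorem for holomorphic maps -/

/-- The weighted `ℓ¹` norms `∑ x, k e x * ‖c x‖`, bundled as a linear map into a product of
`ℓ¹` spaces. -/
def weightedEmbedding {X Y : Type*} [Fintype X] (k : Y → X → ℝ) :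
    (X → ℂ) →ₗ[ℂ] (Y → PiLp 1 fun _ : X => ℂ) where
  toFun c := fun e => WithLp.toLp 1 fun x => (k e x : ℂ) * c x
  map_add' c d := by
    ext e x
    simp [mul_add]
  map_smul' z c := by
    ext e x
    simp [mul_left_comm]

theorem norm_weightedEmbedding_le {X Y : Type*} [Fintype X] [Fintype Y] {k : Y → X → ℝ}
    (hk : ∀ e x, 0 ≤ k e x) (c : X → ℂ) {R : ℝ} (hR : 0 ≤ R) :
    ‖weightedEmbedding k c‖ ≤ R ↔ ∀ e, ∑ x, k e x * ‖c x‖ ≤ R := by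
  rw [pi_norm_le_iff_of_nonneg hR]
  refine forall_congr' fun e => ?_
  rw [PiLp.norm_eq_of_L1]
  simp [weightedEmbedding, abs_of_nonneg (hk e _)]

/-- A holomorphic map sending a ball of a weighted `ℓ¹` norm well inside itself is
contracting on a smaller ball. -/
theorem contracting_of_weighted_bound {X E : Type*} [Fintype X] [NormedAddCommGroup E]
    [NormedSpace ℂ E] {J : (X → ℂ) →ₗ[ℂ] E} {F : (X → ℂ) → X → ℂ} (hF : Differentiable ℂ F)
    {R : ℝ} (hR : 0 < R) (hmaps' : ∀ c, ‖J c‖ ≤ R → ‖J (F c)‖ ≤ R / 16) {c d : X → ℂ}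
    (hc : ‖J c‖ ≤ R / 16) (hd : ‖J d‖ ≤ R / 16) :
    ‖J (F d) - J (F c)‖ ≤ 1 / 2 * ‖J d - J c‖ := by
  rcases (norm_nonneg (J d - J c)).eq_or_lt with hm | hm
  · have hJdc : J (d - c) = 0 := by rw [map_sub]; exact norm_eq_zero.1 hm.symm
    have hle : ∀ z : ℂ, ‖J (c + z • (d - c))‖ ≤ R := fun z => by
      rw [map_add, map_smul, hJdc, smul_zero, add_zero]
      linarith
    have hd' : Differentiable ℂ fun z : ℂ => J (F (c + z • (d - c))) := by
      have : Differentiable ℂ J := (LinearMap.toContinuousLinearMap J).differentiable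
      fun_prop
    have hbdd : Bornology.IsBounded (Set.range fun z : ℂ => J (F (c + z • (d - c)))) := by
      refine (Metric.isBounded_closedBall (x := 0) (r := R / 16)).subset ?_
      rintro _ ⟨z, rfl⟩
      simpa using hmaps' _ (hle z)
    have := hd'.apply_eq_apply_of_bounded hbdd 1 0
    simp only [one_smul, add_sub_cancel, zero_smul, add_zero] at this
    rw [this, ← hm]
    simp
  · set m := ‖J d - J c‖ with hmdef
    have hmR : m ≤ R / 8 := (norm_sub_le _ _).trans (by linarith)
    have hle : ∀ z ∈ Metric.ball (0 : ℂ) (R / (2 * m)), ‖J (c + z • (d - c))‖ ≤ R := by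
      intro z hz
      rw [mem_ball_zero_iff, lt_div_iff₀ (by positivity)] at hz
      rw [map_add, map_smul, map_sub]
      refine (norm_add_le _ _).trans ?_
      rw [norm_smul, ← hmdef]
      linarith
    have hd' : Differentiable ℂ fun z : ℂ => J (F (c + z • (d - c))) := by
      have : Differentiable ℂ J := (LinearMap.toContinuousLinearMap J).differentiable
      fun_prop
    have h := Complex.dist_le_div_mul_dist_of_mapsTo_ball (c := (0 : ℂ)) (z := 1)
      (R₁ := R / (2 * m)) (R₂ := R / 8) hd'.differentiableOn (fun z hz => by
        rw [Metric.mem_closedBall, dist_eq_norm]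
        refine (norm_sub_le _ _).trans ?_
        have h1 := hmaps' _ (hle z hz)
        have h2 := hmaps' _ (hle 0 (Metric.mem_ball_self (by positivity)))
        linarith) (by
        rw [mem_ball_zero_iff, lt_div_iff₀ (by positivity)]
        simp
        linarith)
    simp only [one_smul, add_sub_cancel, zero_smul, add_zero, dist_eq_norm, sub_zero,
      norm_one, mul_one] at h
    refine h.trans ?_
    have : R / 8 / (R / (2 * m)) = m / 4 := by field_simp; norm_num
    rw [this]
    linarith

/-- A holomorphic self-map of a ball for a weighted `ℓ¹` norm, whose image lies well inside
the ball, has a fixed point. -/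
theorem exists_fixedPoint_of_weighted_bound {X Y : Type*} [Fintype X] [Fintype Y]
    {k : Y → X → ℝ} (hk : ∀ e x, 0 ≤ k e x) {F : (X → ℂ) → X → ℂ} (hF : Differentiable ℂ F)
    (hzero : ∀ x, (∀ e, k e x < 1) → ∀ c, F c x = 0) {R : ℝ} (hR : 0 < R)
    (hmaps : ∀ c, (∀ e, ∑ x, k e x * ‖c x‖ ≤ R) → ∀ e, ∑ x, k e x * ‖F c x‖ ≤ R / 16) :
    ∃ c, F c = c ∧ ∀ e, ∑ x, k e x * ‖c x‖ ≤ R := by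
  set J := weightedEmbedding k with hJ
  have hmaps' : ∀ c, ‖J c‖ ≤ R → ‖J (F c)‖ ≤ R / 16 := fun c hc =>
    (norm_weightedEmbedding_le hk _ (by positivity)).2
      (hmaps c ((norm_weightedEmbedding_le hk _ hR.le).1 hc))
  have hlip : ∀ c d, ‖J c‖ ≤ R / 16 → ‖J d‖ ≤ R / 16 →
      ‖J (F d) - J (F c)‖ ≤ 1 / 2 * ‖J d - J c‖ := fun c d hc hd =>
    contracting_of_weighted_bound hF hR hmaps' hc hd
  have hcoord : ∀ c d, ‖F d - F c‖ ≤ ‖J (F d) - J (F c)‖ := by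
    intro c d
    refine (pi_norm_le_iff_of_nonneg (norm_nonneg _)).2 fun x => ?_
    by_cases hx : ∀ e, k e x < 1
    · simp [hzero x hx]
    · push Not at hx
      obtain ⟨e, he⟩ := hx
      have h1 := (norm_weightedEmbedding_le hk (F d - F c) (norm_nonneg (J (F d - F c)))).1
        le_rfl e
      rw [map_sub] at h1
      refine le_trans ?_ h1
      refine le_trans ?_ (Finset.single_le_sum
        (fun y _ => mul_nonneg (hk e y) (norm_nonneg _)) (Finset.mem_univ x))
      exact le_mul_of_one_le_left (norm_nonneg _) he
  obtain ⟨u, hu0, husucc⟩ : ∃ u : ℕ → X → ℂ, u 0 = F 0 ∧ ∀ m, u (m + 1) = F (u m) :=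
    ⟨fun m => F^[m + 1] 0, rfl, fun m => Function.iterate_succ_apply' F (m + 1) 0⟩
  have hub : ∀ m, ‖J (u m)‖ ≤ R / 16 := by
    intro m
    induction m with
    | zero => rw [hu0]; exact hmaps' 0 (by simpa using hR.le)
    | succ m ih => rw [husucc]; exact hmaps' _ (by linarith)
  have hstep : ∀ m, ‖J (u (m + 1)) - J (u m)‖ ≤ R / 8 * (1 / 2) ^ m := by
    intro m
    induction m with
    | zero =>
      have h1 := hub 1
      have h2 := hub 0
      rw [pow_zero, mul_one]
      exact (norm_sub_le _ _).trans (by linarith)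
    | succ m ih =>
      have h := hlip _ _ (hub m) (hub (m + 1))
      rw [← husucc, ← husucc] at h
      refine h.trans ?_
      rw [pow_succ]
      linarith
  have hcauchy : CauchySeq u := by
    refine cauchySeq_of_le_geometric (1 / 2) (R / 8) (by norm_num) fun m => ?_
    rw [dist_comm, dist_eq_norm]
    refine le_trans ?_ (hstep m)
    cases m with
    | zero => rw [husucc, hu0]; exact hcoord _ _
    | succ m => rw [husucc (m + 1), husucc m]; exact hcoord _ _
  obtain ⟨c, hc⟩ := cauchySeq_tendsto_of_complete hcauchy
  refine ⟨c, ?_, ?_⟩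
  · have h1 : Filter.Tendsto (fun m => u (m + 1)) Filter.atTop (nhds (F c)) := by
      simp only [husucc]
      exact (hF.continuous.tendsto c).comp hc
    exact tendsto_nhds_unique h1 (hc.comp (Filter.tendsto_add_atTop_nat 1))
  · refine (norm_weightedEmbedding_le hk c hR.le).1 ?_
    have hJc : Continuous J := (LinearMap.toContinuousLinearMap J).continuous
    exact le_of_tendsto ((hJc.tendsto c).comp hc).norm
      (Filter.Eventually.of_forall fun m => (hub m).trans (by linarith))

/-! ### Cuts of a graph -/

/-- The edges cut by the bipartition `x`; this is the syndrome of the flip operator of `x`. -/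
def cut {n : ℕ} (G : SimpleGraph (Fin n)) [DecidableRel G.Adj] (x : F2vec n) :
    Finset (Sym2 (Fin n)) :=
  isingSyndrome G (x, 0)

/-- The edges of `G` with both endpoints in `S`. -/
def innerEdges {n : ℕ} (G : SimpleGraph (Fin n)) [DecidableRel G.Adj] (S : Finset (Fin n)) :
    Finset (Sym2 (Fin n)) :=
  G.edgeFinset.filter fun e => ∀ i ∈ e, i ∈ S

/-- The eigenvalue of the check of the edge `e` on the basis vector `x`. -/
def cutSign {n : ℕ} (G : SimpleGraph (Fin n)) [DecidableRel G.Adj] (e : Sym2 (Fin n))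
    (x : F2vec n) : ℂ :=
  if e ∈ cut G x then -1 else 1

section Cut

variable {n : ℕ} {G : SimpleGraph (Fin n)} [DecidableRel G.Adj]

theorem zmod_two_cases (t : ZMod 2) : t = 0 ∨ t = 1 := by
  revert t; decide

theorem F2vec.sub_eq_add (x y : F2vec n) : x - y = x + y := by
  ext i
  exact congrFun (congrFun (by decide : (fun s t : ZMod 2 => s - t) = fun s t => s + t) (x i)) (y i)

theorem F2vec.one_ne_zero (hn : 0 < n) : (fun _ => 1 : F2vec n) ≠ 0 := fun h => by
  simpa using congrFun h ⟨0, hn⟩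

theorem sum_isingVec {i j : Fin n} (hij : i ≠ j) {M : Type*} [AddCommMonoid M]
    (f : ZMod 2 → Fin n → M) (hf : ∀ k, f 0 k = 0) :
    ∑ k, f (isingVec s(i, j) k) k = f 1 i + f 1 j := by
  rw [← Finset.sum_pair (f := f 1) hij]
  symm
  refine (Finset.sum_congr rfl fun k hk => ?_).trans
    (Finset.sum_subset (Finset.subset_univ {i, j}) fun k _ hk => ?_)
  · simp only [Finset.mem_insert, Finset.mem_singleton] at hk
    simp [isingVec, hk]
  · simp only [Finset.mem_insert, Finset.mem_singleton] at hk
    simp [isingVec, hk, hf]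

theorem isingSyndrome_eq_cut (p : F2vec n × F2vec n) : isingSyndrome G p = cut G p.1 := by
  simp [isingSyndrome, cut, sympl]

theorem mem_cut {i j : Fin n} {x : F2vec n} :
    s(i, j) ∈ cut G x ↔ G.Adj i j ∧ x i ≠ x j := by
  simp only [cut, isingSyndrome, Finset.mem_filter, SimpleGraph.mem_edgeFinset,
    SimpleGraph.mem_edgeSet]
  refine and_congr_right fun h => ?_
  have hs : sympl (x, 0) ((0 : F2vec n), isingVec s(i, j)) = x i + x j := by
    simp only [sympl, Pi.zero_apply, zero_mul, add_zero]
    simpa using sum_isingVec h.ne (fun t k => x k * t) (by simp)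
  rw [hs]
  generalize x i = s
  generalize x j = t
  revert s t
  decide

theorem cut_subset (x : F2vec n) : cut G x ⊆ G.edgeFinset := Finset.filter_subset _ _

theorem cut_zero : cut G (0 : F2vec n) = ∅ := by
  refine Finset.eq_empty_of_forall_notMem fun e => ?_
  induction e with | _ i j => simp [mem_cut]

theorem mem_cut_add {e : Sym2 (Fin n)} {x y : F2vec n} (h : e ∈ cut G (x + y)) :
    e ∈ cut G x ∨ e ∈ cut G y := by
  induction e with | _ i j =>
  simp only [mem_cut, Pi.add_apply] at h ⊢
  by_contra hc
  simp only [h.1, true_and, not_or, not_not] at hc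
  exact h.2 (by rw [hc.1, hc.2])

theorem cutSign_add (e : Sym2 (Fin n)) (x y : F2vec n) :
    cutSign G e (x + y) = cutSign G e x * cutSign G e y := by
  induction e with | _ i j =>
  simp only [cutSign, mem_cut, Pi.add_apply]
  by_cases h : G.Adj i j
  · have key : ∀ s t u v : ZMod 2, (s + u ≠ t + v) ↔ ¬ ((s ≠ t) ↔ (u ≠ v)) := by decide
    simp only [key (x i) (x j) (y i) (y j)]
    by_cases h1 : x i = x j <;> by_cases h2 : y i = y j <;> simp [h, h1, h2]
  · simp [h]

theorem norm_cutSign (e : Sym2 (Fin n)) (x : F2vec n) : ‖cutSign G e x‖ = 1 := by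
  unfold cutSign; split_ifs <;> simp

theorem cutSign_mul_self (e : Sym2 (Fin n)) (x : F2vec n) :
    cutSign G e x * cutSign G e x = 1 := by
  unfold cutSign; split_ifs <;> simp

theorem SimpleGraph.Connected.apply_eq_of_adj {V α : Type*} {H : SimpleGraph V}
    (hH : H.Connected) {f : V → α} (hf : ∀ i j, H.Adj i j → f i = f j) (i j : V) : f i = f j := by
  obtain ⟨p⟩ := hH.preconnected i j
  induction p with
  | nil => rfl
  | cons h _ ih => exact (hf _ _ h).trans ih

theorem cut_eq_empty (hG : G.Connected) {x : F2vec n} :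
    cut G x = ∅ ↔ x = 0 ∨ x = fun _ => 1 := by
  constructor
  · intro h
    have hc := hG.apply_eq_of_adj (f := x) fun i j hij => by
      by_contra hne
      have : s(i, j) ∈ cut G x := mem_cut.2 ⟨hij, hne⟩
      simp [h] at this
    obtain ⟨i⟩ := hG.nonempty
    rcases zmod_two_cases (x i) with h0 | h0
    · exact Or.inl (funext fun j => (hc j i).trans h0)
    · exact Or.inr (funext fun j => (hc j i).trans h0)
  · rintro (rfl | rfl)
    · exact cut_zero
    · refine Finset.eq_empty_of_forall_notMem fun e => ?_
      induction e with | _ i j => simp [mem_cut]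

theorem cut_add_eq_empty {x y : F2vec n} (h : cut G x = cut G y) : cut G (x + y) = ∅ := by
  refine Finset.eq_empty_of_forall_notMem fun e => ?_
  induction e with | _ i j =>
  have he : s(i, j) ∈ cut G x ↔ s(i, j) ∈ cut G y := by rw [h]
  simp only [mem_cut, Pi.add_apply] at he ⊢
  rintro ⟨hadj, hne⟩
  simp only [hadj, true_and] at he
  have key : ∀ s t u v : ZMod 2, ((s ≠ t) ↔ (u ≠ v)) → s + u = t + v := by decide
  exact hne (key _ _ _ _ he)

theorem card_cut_fiber_le (hG : G.Connected) (s : Finset (Sym2 (Fin n))) :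
    (Finset.univ.filter fun x : F2vec n => cut G x = s).card ≤ 2 := by
  rcases (Finset.univ.filter fun x : F2vec n => cut G x = s).eq_empty_or_nonempty with h | ⟨y, hy⟩
  · simp [h]
  · refine (Finset.card_le_card (t := {y, (fun _ => 1) + y}) fun x hx => ?_).trans
      Finset.card_le_two
    simp only [Finset.mem_filter, Finset.mem_univ, true_and] at hx hy
    have h := (cut_eq_empty hG).1 (cut_add_eq_empty (hx.trans hy.symm))
    have hxy : x = (x + y) + y := by
      rw [add_assoc, ← F2vec.sub_eq_add y y, sub_self, add_zero]
    rcases h with h | h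
    · rw [h, zero_add] at hxy
      simp [hxy]
    · rw [h] at hxy
      simp [hxy]

/-- A bipartition cutting no edge inside a connected set is constant on this set. -/
theorem apply_eq_of_disjoint_innerEdges {S : Finset (Fin n)}
    (hS : (G.induce (S : Set (Fin n))).Connected) {x : F2vec n}
    (hx : Disjoint (cut G x) (innerEdges G S)) {i j : Fin n} (hi : i ∈ S) (hj : j ∈ S) :
    x i = x j := by
  refine hS.apply_eq_of_adj (f := fun k : (S : Set (Fin n)) => x k) (fun k l hkl => ?_)
    ⟨i, hi⟩ ⟨j, hj⟩
  by_contra hne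
  have hadj : G.Adj k l := hkl
  refine Finset.disjoint_left.1 hx (mem_cut.2 ⟨hadj, hne⟩) ?_
  simp only [innerEdges, Finset.mem_filter, SimpleGraph.mem_edgeFinset, SimpleGraph.mem_edgeSet,
    Sym2.mem_iff]
  refine ⟨hadj, ?_⟩
  rintro m (rfl | rfl)
  exacts [k.2, l.2]

theorem card_innerEdges_le {Δ : ℕ} (hΔ : ∀ i, G.degree i ≤ Δ) (S : Finset (Fin n)) :
    (innerEdges G S).card ≤ Δ * S.card := by
  have hsub : innerEdges G S ⊆ S.biUnion fun i => G.incidenceFinset i := by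
    intro e he
    induction e with | _ i j =>
    simp only [innerEdges, Finset.mem_filter, SimpleGraph.mem_edgeFinset] at he
    refine Finset.mem_biUnion.2 ⟨i, he.2 i (by simp), ?_⟩
    rw [SimpleGraph.mem_incidenceFinset]
    exact ⟨he.1, by simp⟩
  refine (Finset.card_le_card hsub).trans (Finset.card_biUnion_le.trans ?_)
  refine (Finset.sum_le_card_nsmul S _ Δ fun i _ => ?_).trans_eq (by simp [mul_comm])
  rw [SimpleGraph.card_incidenceFinset_eq_degree]
  exact hΔ i

theorem card_edgeFinset_le {Δ : ℕ} (hΔ : ∀ i, G.degree i ≤ Δ) :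
    (G.edgeFinset.card : ℝ) ≤ Δ * n := by
  have h := card_innerEdges_le hΔ Finset.univ
  simp only [innerEdges, Finset.mem_univ, implies_true, Finset.filter_true,
    Finset.card_univ, Fintype.card_fin] at h
  exact_mod_cast h

/-! ### The Ising Hamiltonian and the terms of the perturbation -/

theorem pauli_isingVec {e : Sym2 (Fin n)} (he : e ∈ G.edgeFinset) :
    pauli ((0 : F2vec n), isingVec e) = Matrix.diagonal (cutSign G e) := by
  induction e with | _ i j =>
  have hadj : G.Adj i j := by simpa using he
  ext a b
  by_cases hab : a = b
  · subst hab
    have hs : ∑ k, (isingVec s(i, j) k).val * (a k).val = (a i).val + (a j).val := by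
      simpa [ZMod.val_one] using
        sum_isingVec hadj.ne (fun t k => t.val * (a k).val) (by simp)
    simp only [pauli, add_zero, if_true, hs, Matrix.diagonal_apply_eq, cutSign, mem_cut, hadj,
      true_and, Pi.zero_apply, zero_ne_one, false_and, Finset.filter_false, Finset.card_empty,
      pow_zero, one_mul]
    rcases zmod_two_cases (a i) with h1 | h1 <;> rcases zmod_two_cases (a j) with h2 | h2 <;>
      simp [h1, h2, ZMod.val_one]
  · simp [pauli, hab]

theorem ising_hamiltonian_eq_diagonal :
    ∑ e ∈ G.edgeFinset,
      ((2 : ℂ))⁻¹ • ((1 : Matrix (F2vec n) (F2vec n) ℂ) - pauli ((0 : F2vec n), isingVec e)) =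
    Matrix.diagonal fun x => ((cut G x).card : ℂ) := by
  rw [Finset.sum_congr rfl fun e he => by rw [pauli_isingVec (G := G) he]]
  ext a b
  by_cases hab : a = b
  · subst hab
    rw [Matrix.sum_apply, Matrix.diagonal_apply_eq]
    have hterm : ∀ e, ((2 : ℂ)⁻¹ • ((1 : Matrix (F2vec n) (F2vec n) ℂ) -
        Matrix.diagonal (cutSign G e))) a a = if e ∈ cut G a then 1 else 0 := by
      intro e
      simp only [Matrix.smul_apply, Matrix.sub_apply, Matrix.one_apply_eq,
        Matrix.diagonal_apply_eq, cutSign, smul_eq_mul]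
      split_ifs <;> norm_num
    simp only [hterm]
    rw [Finset.sum_ite_mem, Finset.inter_eq_right.2 (cut_subset a)]
    simp
  · rw [Matrix.sum_apply, Matrix.diagonal_apply_ne _ hab]
    exact Finset.sum_eq_zero fun e _ => by simp [hab]

/-- The permutation matrix translating the basis by `y`. -/
def shiftMatrix (y : F2vec n) : Matrix (F2vec n) (F2vec n) ℂ :=
  Matrix.circulant (Pi.single y 1)

theorem shiftMatrix_apply (y a b : F2vec n) :
    shiftMatrix y a b = if a - b = y then 1 else 0 := by
  simp [shiftMatrix, Matrix.circulant_apply, Pi.single_apply]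

theorem pauli_flip : pauli ((fun _ => 1 : F2vec n), (0 : F2vec n)) = shiftMatrix fun _ => 1 := by
  ext a b
  rw [shiftMatrix_apply]
  simp [pauli, sub_eq_iff_eq_add, add_comm]

theorem commute_shiftMatrix_iff {y : F2vec n} {M : Matrix (F2vec n) (F2vec n) ℂ} :
    Commute (shiftMatrix y) M ↔ ∀ a b, M (a + y) (b + y) = M a b := by
  have h1 : ∀ a b, (shiftMatrix y * M) a b = M (a - y) b := by
    intro a b
    rw [Matrix.mul_apply, Finset.sum_eq_single (a - y)]
    · simp [shiftMatrix_apply]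
    · intro c _ hc
      rw [shiftMatrix_apply, if_neg, zero_mul]
      rintro rfl
      simp at hc
    · simp
  have h2 : ∀ a b, (M * shiftMatrix y) a b = M a (b + y) := by
    intro a b
    rw [Matrix.mul_apply, Finset.sum_eq_single (b + y)]
    · simp [shiftMatrix_apply]
    · intro c _ hc
      rw [shiftMatrix_apply, if_neg, mul_zero]
      rintro rfl
      simp at hc
    · simp
  constructor
  · intro h a b
    have := congrFun (congrFun h.eq (a + y)) b
    rw [h1, h2, add_sub_cancel_right] at this
    exact this.symm
  · intro h
    ext a b
    rw [h1, h2, ← h (a - y) b, sub_add_cancel]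

theorem circulant_eq_sum_shiftMatrix (v : F2vec n → ℂ) :
    Matrix.circulant v = ∑ x, v x • shiftMatrix x := by
  ext a b
  rw [Matrix.sum_apply, Finset.sum_eq_single (a - b)]
  · simp [shiftMatrix_apply]
  · intro c _ hc
    simp [shiftMatrix_apply, hc.symm]
  · simp

theorem commute_circulant {v : F2vec n → ℂ} {M : Matrix (F2vec n) (F2vec n) ℂ}
    (h : ∀ x, v x ≠ 0 → Commute (shiftMatrix x) M) : Commute (Matrix.circulant v) M := by
  rw [circulant_eq_sum_shiftMatrix]
  refine Commute.sum_left _ _ _ fun x _ => ?_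
  by_cases hx : v x = 0
  · simp [hx]
  · exact (h x hx).smul_left _

theorem pauli_add_add (p : F2vec n × F2vec n) {y : F2vec n} (hy : ∀ i ∈ pSupp p, y i = 0)
    (a b : F2vec n) : pauli p (a + y) (b + y) = pauli p a b := by
  have hcond : a + y = b + y + p.1 ↔ a = b + p.1 := by
    rw [add_right_comm, add_left_inj]
  have hsum : ∑ i, (p.2 i).val * ((b + y) i).val = ∑ i, (p.2 i).val * (b i).val := by
    refine Finset.sum_congr rfl fun i _ => ?_
    by_cases hi : p.2 i = 0
    · simp [hi]
    · simp [hy i (by simp [pSupp, hi])]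
  simp only [pauli, hcond, hsum]

theorem IsingStronglySupported.apply_add_add {M : Matrix (F2vec n) (F2vec n) ℂ}
    {S : Finset (Fin n)} {s : Finset (Sym2 (Fin n))} (hM : IsingStronglySupported G M S s)
    {y : F2vec n} (hy : ∀ i ∈ S, y i = 0) (a b : F2vec n) : M (a + y) (b + y) = M a b := by
  refine Submodule.span_induction (p := fun A _ => A (a + y) (b + y) = A a b)
    ?_ rfl (fun A B _ _ hA hB => ?_) (fun c A _ hA => ?_) hM.1
  · rintro _ ⟨p, rfl, hp, -⟩
    exact pauli_add_add p (fun i hi => hy i (hp hi)) a b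
  · simp only [Matrix.add_apply, hA, hB]
  · simp only [Matrix.smul_apply, hA]

theorem IsingStronglySupported.of_apply_ne_zero {M : Matrix (F2vec n) (F2vec n) ℂ}
    {S : Finset (Fin n)} {s : Finset (Sym2 (Fin n))} (hM : IsingStronglySupported G M S s)
    {a b : F2vec n} (hab : M a b ≠ 0) : (∀ i, (a - b) i ≠ 0 → i ∈ S) ∧ cut G (a - b) = s := by
  by_contra hc
  refine hab (Submodule.span_induction (p := fun A _ => A a b = 0)
    ?_ rfl (fun A B _ _ hA hB => ?_) (fun c A _ hA => ?_) hM.1)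
  · rintro _ ⟨p, rfl, hp, hs⟩
    rw [pauli, if_neg]
    rintro rfl
    refine hc ?_
    rw [add_sub_cancel_left]
    exact ⟨fun i hi => hp (by simp [pSupp, hi]), (isingSyndrome_eq_cut p).symm.trans hs⟩
  · simp only [Matrix.add_apply, hA, hB, add_zero]
  · simp only [Matrix.smul_apply, hA, smul_zero]

theorem IsingStronglySupported.subset_innerEdges {M : Matrix (F2vec n) (F2vec n) ℂ}
    {S : Finset (Fin n)} {s : Finset (Sym2 (Fin n))} (hM : IsingStronglySupported G M S s)
    {x : F2vec n} (hx : cut G x = s) : s ⊆ innerEdges G S := by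
  intro e he
  refine Finset.mem_filter.2 ⟨cut_subset x (hx ▸ he), fun i hi => hM.2 e he ?_⟩
  simp [pSupp, isingVec, hi]

/-- A symmetric term on a connected set commutes with all flips cutting no edge inside it. -/
theorem IsingStronglySupported.commute_shiftMatrix {M : Matrix (F2vec n) (F2vec n) ℂ}
    {S : Finset (Fin n)} {s : Finset (Sym2 (Fin n))} (hM : IsingStronglySupported G M S s)
    (hS : (G.induce (S : Set (Fin n))).Connected)
    (hflip : Commute (shiftMatrix fun _ => 1) M) {y : F2vec n}
    (hy : Disjoint (cut G y) (innerEdges G S)) : Commute (shiftMatrix y) M := by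
  rw [commute_shiftMatrix_iff] at hflip ⊢
  intro a b
  obtain ⟨⟨i, hi⟩⟩ := hS.nonempty
  rcases zmod_two_cases (y i) with h0 | h0
  · exact hM.apply_add_add
      (fun j hj => (apply_eq_of_disjoint_innerEdges hS hy hj hi).trans h0) a b
  · have hy' : ∀ j ∈ S, (y + (fun _ => 1 : F2vec n)) j = 0 := fun j hj => by
      rw [Pi.add_apply, apply_eq_of_disjoint_innerEdges hS hy hj hi, h0]
      decide
    rw [← hflip, add_assoc, add_assoc]
    exact hM.apply_add_add hy' a b

theorem norm_apply_le_opNorm (M : Matrix (F2vec n) (F2vec n) ℂ) (a b : F2vec n) :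
    ‖M a b‖ ≤ opNorm M := by
  have h := (Matrix.toEuclideanCLM (𝕜 := ℂ) M).le_opNorm (EuclideanSpace.single b 1)
  rw [PiLp.norm_single, norm_one, mul_one] at h
  refine le_trans ?_ h
  refine le_trans (le_of_eq ?_) (PiLp.norm_apply_le _ a)
  simp [Matrix.ofLp_toEuclideanCLM]

theorem opNorm_nonneg (M : Matrix (F2vec n) (F2vec n) ℂ) : 0 ≤ opNorm M := norm_nonneg _

end Cut

/-! ### Exponential weights -/

/-- The exponential weight of a flip pattern in terms of its number of flipped sites. -/
def flipWeight {n : ℕ} (κ : ℝ) (x : F2vec n) : ℝ :=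
  Real.exp (κ * (Finset.univ.filter fun i => x i ≠ 0).card)

/-- The exponential weight restricted to flip patterns that cut the edge `e`. -/
def cutWeight {n : ℕ} (G : SimpleGraph (Fin n)) [DecidableRel G.Adj] (κ : ℝ)
    (e : Sym2 (Fin n)) (x : F2vec n) : ℝ :=
  if e ∈ cut G x then flipWeight κ x else 0

section Weight

variable {n : ℕ} {G : SimpleGraph (Fin n)} [DecidableRel G.Adj] {κ : ℝ}

theorem flipWeight_nonneg (x : F2vec n) : 0 ≤ flipWeight κ x := (Real.exp_pos _).le

theorem flipWeight_zero : flipWeight κ (0 : F2vec n) = 1 := by simp [flipWeight]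

theorem one_le_flipWeight (hκ : 0 ≤ κ) (x : F2vec n) : 1 ≤ flipWeight κ x :=
  Real.one_le_exp (by positivity)

theorem flipWeight_one : flipWeight κ (fun _ => 1 : F2vec n) = Real.exp (κ * n) := by
  simp [flipWeight]

theorem flipWeight_add (hκ : 0 ≤ κ) (x y : F2vec n) :
    flipWeight κ (x + y) ≤ flipWeight κ x * flipWeight κ y := by
  rw [flipWeight, flipWeight, flipWeight, ← Real.exp_add, ← mul_add, Real.exp_le_exp]
  refine mul_le_mul_of_nonneg_left ?_ hκ
  have : (Finset.univ.filter fun i => (x + y) i ≠ 0) ⊆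
      (Finset.univ.filter fun i => x i ≠ 0) ∪ Finset.univ.filter fun i => y i ≠ 0 := by
    intro i
    simp only [Finset.mem_filter, Finset.mem_univ, true_and, Finset.mem_union, Pi.add_apply]
    intro h
    by_contra hc
    simp only [not_or, not_not] at hc
    exact h (by rw [hc.1, hc.2, add_zero])
  exact_mod_cast (Finset.card_le_card this).trans (Finset.card_union_le _ _)

theorem flipWeight_le (hκ : 0 ≤ κ) {x : F2vec n} {S : Finset (Fin n)}
    (h : ∀ i, x i ≠ 0 → i ∈ S) : flipWeight κ x ≤ Real.exp (κ * S.card) := by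
  refine Real.exp_le_exp.2 (mul_le_mul_of_nonneg_left ?_ hκ)
  exact_mod_cast Finset.card_le_card fun i hi => h i (by simpa using hi)

theorem cutWeight_nonneg (e : Sym2 (Fin n)) (x : F2vec n) : 0 ≤ cutWeight G κ e x := by
  unfold cutWeight
  split_ifs
  exacts [flipWeight_nonneg x, le_rfl]

theorem cutWeight_le (e : Sym2 (Fin n)) (x : F2vec n) : cutWeight G κ e x ≤ flipWeight κ x := by
  unfold cutWeight
  split_ifs
  exacts [le_rfl, flipWeight_nonneg x]

theorem cutWeight_zero (e : Sym2 (Fin n)) : cutWeight G κ e 0 = 0 := by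
  simp [cutWeight, cut_zero]

theorem cutWeight_add (hκ : 0 ≤ κ) (e : Sym2 (Fin n)) (x y : F2vec n) :
    cutWeight G κ e (x + y) ≤
      cutWeight G κ e x * flipWeight κ y + flipWeight κ x * cutWeight G κ e y := by
  have hx := flipWeight_nonneg (κ := κ) x
  have hy := flipWeight_nonneg (κ := κ) y
  have hxy := flipWeight_add hκ x y
  have h0 := mul_nonneg hx hy
  by_cases h : e ∈ cut G (x + y)
  · rcases mem_cut_add h with h1 | h1
    · have := mul_nonneg hx (cutWeight_nonneg (G := G) (κ := κ) e y)
      simp only [cutWeight, h, h1, if_true] at this ⊢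
      linarith
    · have := mul_nonneg (cutWeight_nonneg (G := G) (κ := κ) e x) hy
      simp only [cutWeight, h, h1, if_true] at this ⊢
      linarith
  · rw [cutWeight, if_neg h]
    exact add_nonneg (mul_nonneg (cutWeight_nonneg e x) hy) (mul_nonneg hx (cutWeight_nonneg e y))

theorem IsingStronglySupported.colBound_flipWeight (hG : G.Connected) (hκ : 0 ≤ κ)
    {M : Matrix (F2vec n) (F2vec n) ℂ} {S : Finset (Fin n)} {s : Finset (Sym2 (Fin n))}
    (hM : IsingStronglySupported G M S s) :
    ColBound (flipWeight κ) M (2 * (opNorm M * Real.exp (κ * S.card))) := fun b => by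
  have hsub : ∑ a, ‖M a b‖ * flipWeight κ (a - b) ≤
      ∑ a, if cut G (a - b) = s then opNorm M * Real.exp (κ * S.card) else 0 := by
    refine Finset.sum_le_sum fun a _ => ?_
    by_cases h : M a b = 0
    · rw [h, norm_zero, zero_mul]
      split_ifs
      · exact mul_nonneg (opNorm_nonneg M) (Real.exp_pos _).le
      · exact le_rfl
    · obtain ⟨h1, h2⟩ := hM.of_apply_ne_zero h
      rw [if_pos h2]
      exact mul_le_mul (norm_apply_le_opNorm M a b) (flipWeight_le hκ h1)
        (flipWeight_nonneg _) (opNorm_nonneg M)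
  refine hsub.trans ?_
  refine (Equiv.sum_comp (Equiv.subRight b) fun x =>
    if cut G x = s then opNorm M * Real.exp (κ * S.card) else 0).trans_le ?_
  rw [← Finset.sum_filter, Finset.sum_const, nsmul_eq_mul]
  refine mul_le_mul_of_nonneg_right ?_ (mul_nonneg (opNorm_nonneg M) (Real.exp_pos _).le)
  exact_mod_cast card_cut_fiber_le hG s

theorem IsingStronglySupported.colBound_cutWeight (hG : G.Connected) (hκ : 0 ≤ κ)
    {M : Matrix (F2vec n) (F2vec n) ℂ} {S : Finset (Fin n)} {s : Finset (Sym2 (Fin n))}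
    (hM : IsingStronglySupported G M S s) (f : Sym2 (Fin n)) :
    ColBound (cutWeight G κ f) M
      (if f ∈ innerEdges G S then 2 * (opNorm M * Real.exp (κ * S.card)) else 0) := fun b => by
  split_ifs with hf
  · exact (Finset.sum_le_sum fun a _ => mul_le_mul_of_nonneg_left (cutWeight_le f _)
      (norm_nonneg _)).trans (hM.colBound_flipWeight hG hκ b)
  · refine (Finset.sum_eq_zero fun a _ => ?_).le
    by_cases h : M a b = 0
    · simp [h]
    · have h2 := (hM.of_apply_ne_zero h).2
      rw [cutWeight, if_neg, mul_zero]
      exact fun hc => hf (hM.subset_innerEdges h2 (h2 ▸ hc))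

end Weight

/-! ### The dressing transformation -/

section MatrixExp

variable {Γ : Type*} [Fintype Γ] [DecidableEq Γ]

theorem Matrix.exp_neg_mul_exp (C : Matrix Γ Γ ℂ) :
    NormedSpace.exp (-C) * NormedSpace.exp C = 1 := by
  rw [← Matrix.exp_add_of_commute _ _ (Commute.neg_left (Commute.refl C)), neg_add_cancel,
    NormedSpace.exp_zero]

theorem Matrix.exp_conj_add {B C M : Matrix Γ Γ ℂ} (hBM : Commute B M) (hBC : Commute B C) :
    NormedSpace.exp (-(B + C)) * M * NormedSpace.exp (B + C) =
      NormedSpace.exp (-C) * M * NormedSpace.exp C := by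
  have h1 : NormedSpace.exp (-(B + C)) = NormedSpace.exp (-C) * NormedSpace.exp (-B) := by
    rw [← Matrix.exp_add_of_commute _ _ hBC.symm.neg_left.neg_right, neg_add_rev]
  have h2 : NormedSpace.exp (-B) * M = M * NormedSpace.exp (-B) := hBM.neg_left.exp_left.eq
  rw [h1, Matrix.exp_add_of_commute _ _ hBC]
  calc NormedSpace.exp (-C) * NormedSpace.exp (-B) * M *
        (NormedSpace.exp B * NormedSpace.exp C)
      = NormedSpace.exp (-C) * (NormedSpace.exp (-B) * M) *
        (NormedSpace.exp B * NormedSpace.exp C) := by simp only [mul_assoc]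
    _ = NormedSpace.exp (-C) * M * (NormedSpace.exp (-B) * NormedSpace.exp B) *
        NormedSpace.exp C := by rw [h2]; simp only [mul_assoc]
    _ = NormedSpace.exp (-C) * M * NormedSpace.exp C := by
        rw [Matrix.exp_neg_mul_exp, mul_one]

theorem Matrix.exp_conj_of_anticommute {C Z : Matrix Γ Γ ℂ} (hZ : Z * Z = 1)
    (hZC : Z * C = -(C * Z)) :
    NormedSpace.exp (-C) * Z * NormedSpace.exp C = Z * NormedSpace.exp ((2 : ℂ) • C) := by
  have h1 : NormedSpace.exp (Z * C * Z) = Z * NormedSpace.exp C * Z :=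
    Matrix.exp_units_conj ⟨Z, Z, hZ, hZ⟩ C
  have h2 : Z * C * Z = -C := by rw [hZC, neg_mul, mul_assoc, hZ, mul_one]
  rw [h2] at h1
  rw [h1, mul_assoc (Z * NormedSpace.exp C), hZ, mul_one, two_smul,
    Matrix.exp_add_of_commute _ _ (Commute.refl C), mul_assoc]

end MatrixExp

/-- The circulant matrix of the pointwise product `m * c`, as a linear function of `c`. -/
def circulantMul {n : ℕ} (m : F2vec n → ℂ) :
    (F2vec n → ℂ) →ₗ[ℂ] Matrix (F2vec n) (F2vec n) ℂ where
  toFun c := Matrix.circulant fun x => m x * c x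
  map_add' c d := by
    ext a b
    simp [Matrix.circulant_apply, mul_add]
  map_smul' z c := by
    ext a b
    simp [Matrix.circulant_apply, mul_left_comm]

section Dressing

variable {n : ℕ} (G : SimpleGraph (Fin n)) [DecidableRel G.Adj]

/-- The inverse size of the cut of `x`. -/
def invCut (x : F2vec n) : ℂ := ((cut G x).card : ℂ)⁻¹

/-- The inverse size of the cut of `x` if `e` is cut, and zero otherwise. -/
def invCutAt (e : Sym2 (Fin n)) (x : F2vec n) : ℂ := if e ∈ cut G x then invCut G x else 0

/-- The inverse size of the cut of `x` if some edge inside `S` is cut, and zero otherwise. -/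
def invCutIn (S : Finset (Fin n)) (x : F2vec n) : ℂ :=
  if Disjoint (cut G x) (innerEdges G S) then 0 else invCut G x

/-- Conjugation by the exponential of the generator with coefficients `c x / |cut x|`. -/
def dress (c : F2vec n → ℂ) (M : Matrix (F2vec n) (F2vec n) ℂ) :
    Matrix (F2vec n) (F2vec n) ℂ :=
  NormedSpace.exp (-circulantMul (invCut G) c) * M * NormedSpace.exp (circulantMul (invCut G) c)

/-- The dressed Hamiltonian without the terms of first order in the generator coming from the
Ising Hamiltonian. -/
def dressRemainder (V : Matrix (F2vec n) (F2vec n) ℂ) (c : F2vec n → ℂ) :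
    Matrix (F2vec n) (F2vec n) ℂ :=
  -((2 : ℂ)⁻¹ • ∑ e ∈ G.edgeFinset, Matrix.diagonal (cutSign G e) *
    (NormedSpace.exp ((2 : ℂ) • circulantMul (invCutAt G e) c) - 1 -
      (2 : ℂ) • circulantMul (invCutAt G e) c)) + dress G c V

/-- The map whose fixed points make the dressed Hamiltonian preserve the ground space. -/
def dressMap (V : Matrix (F2vec n) (F2vec n) ℂ) (c : F2vec n → ℂ) (x : F2vec n) : ℂ :=
  if cut G x = ∅ then 0 else -dressRemainder G V c x 0

variable {G}

theorem norm_invCut (x : F2vec n) : ‖invCut G x‖ = ((cut G x).card : ℝ)⁻¹ := by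
  simp [invCut]

theorem card_mul_norm_invCut_le (x : F2vec n) : ((cut G x).card : ℝ) * ‖invCut G x‖ ≤ 1 := by
  rw [norm_invCut]
  exact mul_inv_le_one

theorem norm_invCut_le_one (x : F2vec n) : ‖invCut G x‖ ≤ 1 := by
  rw [norm_invCut]
  exact Nat.cast_inv_le_one _

theorem circulantMul_commute (m m' c c' : F2vec n → ℂ) :
    Commute (circulantMul m c) (circulantMul m' c') :=
  Matrix.circulant_mul_comm _ _

theorem commute_shiftMatrix_circulantMul (y : F2vec n) (m c : F2vec n → ℂ) :
    Commute (shiftMatrix y) (circulantMul m c) :=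
  Matrix.circulant_mul_comm _ _

theorem circulantMul_add_left (m m' c : F2vec n → ℂ) :
    circulantMul (m + m') c = circulantMul m c + circulantMul m' c := by
  ext a b
  simp [circulantMul, Matrix.circulant_apply, add_mul]

theorem commute_shiftMatrix_dress {c : F2vec n → ℂ} {M : Matrix (F2vec n) (F2vec n) ℂ}
    {y : F2vec n} (h : Commute (shiftMatrix y) M) : Commute (shiftMatrix y) (dress G c M) :=
  ((commute_shiftMatrix_circulantMul y _ c).neg_right.exp_right.mul_right h).mul_right
    (commute_shiftMatrix_circulantMul y _ c).exp_right

theorem dress_eq_of_commute {c : F2vec n → ℂ} {M : Matrix (F2vec n) (F2vec n) ℂ}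
    {S : Finset (Fin n)}
    (h : ∀ y, Disjoint (cut G y) (innerEdges G S) → Commute (shiftMatrix y) M) :
    dress G c M = NormedSpace.exp (-circulantMul (invCutIn G S) c) * M *
      NormedSpace.exp (circulantMul (invCutIn G S) c) := by
  have hsplit : circulantMul (invCut G) c =
      circulantMul (invCut G - invCutIn G S) c + circulantMul (invCutIn G S) c := by
    rw [← circulantMul_add_left, sub_add_cancel]
  rw [dress, hsplit]
  refine Matrix.exp_conj_add (commute_circulant fun x hx => h x ?_) (circulantMul_commute _ _ _ _)
  by_contra hd
  simp [invCutIn, hd] at hx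

theorem diagonal_cutSign_mul_circulantMul_apply (e : Sym2 (Fin n)) (m c : F2vec n → ℂ)
    (a b : F2vec n) : (Matrix.diagonal (cutSign G e) * circulantMul m c) a b =
      cutSign G e (a - b) * (circulantMul m c * Matrix.diagonal (cutSign G e)) a b := by
  rw [Matrix.diagonal_mul, Matrix.mul_diagonal]
  conv_lhs => rw [← sub_add_cancel a b, cutSign_add, sub_add_cancel]
  ring

theorem dress_diagonal_cutSign (c : F2vec n → ℂ) (e : Sym2 (Fin n)) :
    dress G c (Matrix.diagonal (cutSign G e)) = Matrix.diagonal (cutSign G e) *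
      NormedSpace.exp ((2 : ℂ) • circulantMul (invCutAt G e) c) := by
  have hsplit : circulantMul (invCut G) c =
      circulantMul (invCut G - invCutAt G e) c + circulantMul (invCutAt G e) c := by
    rw [← circulantMul_add_left, sub_add_cancel]
  rw [dress, hsplit, Matrix.exp_conj_add _ (circulantMul_commute _ _ _ _)]
  · refine Matrix.exp_conj_of_anticommute ?_ ?_
    · rw [Matrix.diagonal_mul_diagonal]
      simp [cutSign_mul_self]
    · ext a b
      rw [diagonal_cutSign_mul_circulantMul_apply, Matrix.neg_apply, Matrix.mul_diagonal]
      by_cases h : e ∈ cut G (a - b)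
      · have hsign : cutSign G e (a - b) = -1 := by simp [cutSign, h]
        rw [hsign, neg_one_mul]
      · simp [circulantMul, Matrix.circulant_apply, invCutAt, h]
  · symm
    ext a b
    rw [diagonal_cutSign_mul_circulantMul_apply, Matrix.mul_diagonal]
    by_cases h : e ∈ cut G (a - b)
    · simp [circulantMul, Matrix.circulant_apply, invCutAt, h]
    · simp [cutSign, h]

section Differentiability

attribute [local instance] Matrix.linftyOpNormedRing Matrix.linftyOpNormedAlgebra

theorem differentiable_dressMap (V : Matrix (F2vec n) (F2vec n) ℂ) :
    Differentiable ℂ (dressMap G V) := by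
  have hlin : ∀ m : F2vec n → ℂ, Differentiable ℂ fun c => circulantMul m c := fun m =>
    (LinearMap.toContinuousLinearMap (circulantMul m)).differentiable
  have hexp : Differentiable ℂ
      (NormedSpace.exp : Matrix (F2vec n) (F2vec n) ℂ → Matrix (F2vec n) (F2vec n) ℂ) :=
    fun M => (NormedSpace.exp_analytic (𝕂 := ℂ) M).differentiableAt
  have hrem : Differentiable ℂ (dressRemainder G V) := by
    unfold dressRemainder dress
    fun_prop
  refine differentiable_pi.2 fun x => ?_
  unfold dressMap
  split_ifs
  · exact differentiable_const _
  · exact ((LinearMap.toContinuousLinearMap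
      (Matrix.entryLinearMap ℂ ℂ x (0 : F2vec n))).differentiable.comp hrem).neg

end Differentiability

/-! ### Bounds on the dressed terms -/

variable {κ N : ℝ} {c : F2vec n → ℂ}

theorem colBound_circulantMul_invCutAt
    (hc : ∀ e, ∑ x, cutWeight G κ e x * ‖c x‖ ≤ N) (e : Sym2 (Fin n)) :
    ColBound (flipWeight κ) (circulantMul (invCutAt G e) c) N := by
  refine (ColBound.circulant _).mono ((Finset.sum_le_sum fun x _ => ?_).trans (hc e))
  unfold invCutAt cutWeight
  split_ifs
  · rw [norm_mul, mul_comm (flipWeight κ x)]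
    exact mul_le_mul_of_nonneg_right
      (mul_le_of_le_one_left (norm_nonneg _) (norm_invCut_le_one x)) (flipWeight_nonneg x)
  · simp

theorem sum_norm_invCutAt_le (hc : ∀ e, ∑ x, cutWeight G κ e x * ‖c x‖ ≤ N)
    (f : Sym2 (Fin n)) :
    ∑ e ∈ G.edgeFinset, ∑ x, ‖invCutAt G e x * c x‖ * cutWeight G κ f x ≤ N := by
  rw [Finset.sum_comm]
  refine (Finset.sum_le_sum fun x _ => ?_).trans (hc f)
  rw [← Finset.sum_mul, mul_comm]
  refine mul_le_mul_of_nonneg_left ?_ (cutWeight_nonneg f x)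
  have : ∀ e, ‖invCutAt G e x * c x‖ = if e ∈ cut G x then ‖invCut G x‖ * ‖c x‖ else 0 := by
    intro e
    unfold invCutAt
    split_ifs <;> simp
  simp only [this]
  rw [Finset.sum_ite_mem, Finset.inter_eq_right.2 (cut_subset x), Finset.sum_const, nsmul_eq_mul,
    ← mul_assoc]
  exact mul_le_of_le_one_left (norm_nonneg _) (card_mul_norm_invCut_le x)

theorem norm_invCutIn_le (S : Finset (Fin n)) (x : F2vec n) :
    ‖invCutIn G S x‖ ≤ ∑ e ∈ innerEdges G S, ‖invCutAt G e x‖ := by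
  unfold invCutIn
  split_ifs with h
  · rw [norm_zero]
    exact Finset.sum_nonneg fun _ _ => norm_nonneg _
  · obtain ⟨e, he, he'⟩ := Finset.not_disjoint_iff.1 h
    refine le_trans (le_of_eq ?_) (Finset.single_le_sum (fun _ _ => norm_nonneg _) he')
    simp [invCutAt, he]

theorem colBound_circulantMul_invCutIn
    (hc : ∀ e, ∑ x, cutWeight G κ e x * ‖c x‖ ≤ N) (S : Finset (Fin n)) :
    ColBound (flipWeight κ) (circulantMul (invCutIn G S) c) ((innerEdges G S).card * N) := by
  refine (ColBound.circulant _).mono ?_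
  calc ∑ x, ‖invCutIn G S x * c x‖ * flipWeight κ x
      ≤ ∑ x, ∑ e ∈ innerEdges G S, ‖invCutAt G e x‖ * ‖c x‖ * flipWeight κ x := by
        refine Finset.sum_le_sum fun x _ => ?_
        rw [norm_mul, ← Finset.sum_mul, ← Finset.sum_mul]
        exact mul_le_mul_of_nonneg_right (mul_le_mul_of_nonneg_right (norm_invCutIn_le S x)
          (norm_nonneg _)) (flipWeight_nonneg x)
    _ = ∑ e ∈ innerEdges G S, ∑ x, ‖invCutAt G e x‖ * ‖c x‖ * flipWeight κ x :=
        Finset.sum_comm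
    _ ≤ ∑ e ∈ innerEdges G S, N := by
        refine Finset.sum_le_sum fun e _ => (Finset.sum_le_sum fun x _ => ?_).trans (hc e)
        unfold invCutAt cutWeight
        split_ifs
        · rw [mul_comm (flipWeight κ x)]
          exact mul_le_mul_of_nonneg_right
            (mul_le_of_le_one_left (norm_nonneg _) (norm_invCut_le_one x)) (flipWeight_nonneg x)
        · simp
    _ = (innerEdges G S).card * N := by simp

variable {M : Matrix (F2vec n) (F2vec n) ℂ} {S : Finset (Fin n)} {s : Finset (Sym2 (Fin n))}

theorem exp_card_innerEdges_le {Δ : ℕ} (hΔ : ∀ i, G.degree i ≤ Δ) (hN : 0 ≤ N)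
    (hNκ : 2 * Δ * N ≤ κ) {v : ℝ} (hv : 0 ≤ v) (S : Finset (Fin n)) :
    Real.exp ((innerEdges G S).card * N) * (2 * (v * Real.exp (κ * S.card))) *
      Real.exp ((innerEdges G S).card * N) ≤ 2 * (v * Real.exp (2 * κ * S.card)) := by
  have h1 : ((innerEdges G S).card : ℝ) ≤ Δ * S.card := by
    exact_mod_cast card_innerEdges_le hΔ S
  have h2 : (innerEdges G S).card * N + κ * S.card + (innerEdges G S).card * N ≤
      2 * κ * S.card := by
    have h3 := mul_le_mul_of_nonneg_right h1 hN
    have h4 := mul_le_mul_of_nonneg_right hNκ (Nat.cast_nonneg' (α := ℝ) S.card)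
    nlinarith
  calc _ = 2 * (v * Real.exp ((innerEdges G S).card * N + κ * S.card +
        (innerEdges G S).card * N)) := by
        rw [Real.exp_add, Real.exp_add]
        ring
    _ ≤ _ := by gcongr

theorem colBound_dress (hG : G.Connected) {Δ : ℕ} (hΔ : ∀ i, G.degree i ≤ Δ) (hκ : 0 ≤ κ)
    (hN : 0 ≤ N) (hNκ : 2 * Δ * N ≤ κ) (hc : ∀ e, ∑ x, cutWeight G κ e x * ‖c x‖ ≤ N)
    (hM : IsingStronglySupported G M S s)
    (hcomm : ∀ y, Disjoint (cut G y) (innerEdges G S) → Commute (shiftMatrix y) M) :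
    ColBound (flipWeight κ) (dress G c M) (2 * (opNorm M * Real.exp (2 * κ * S.card))) := by
  have hC := colBound_circulantMul_invCutIn hc S
  have he := hC.exp flipWeight_nonneg flipWeight_zero (flipWeight_add hκ)
  have he' := hC.neg.exp flipWeight_nonneg flipWeight_zero (flipWeight_add hκ)
  rw [dress_eq_of_commute hcomm]
  exact ((he'.mul flipWeight_nonneg (flipWeight_add hκ) (hM.colBound_flipWeight hG hκ)).mul
    flipWeight_nonneg (flipWeight_add hκ) he).mono
      (exp_card_innerEdges_le hΔ hN hNκ (opNorm_nonneg M) S)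

theorem colBound_dress_cutWeight (hG : G.Connected) {Δ : ℕ} (hΔ : ∀ i, G.degree i ≤ Δ)
    (hκ : 0 ≤ κ) (hN : 0 ≤ N) (hNκ : 2 * Δ * N ≤ κ)
    (hc : ∀ e, ∑ x, cutWeight G κ e x * ‖c x‖ ≤ N)
    (hM : IsingStronglySupported G M S s)
    (hcomm : ∀ y, Disjoint (cut G y) (innerEdges G S) → Commute (shiftMatrix y) M)
    (f : Sym2 (Fin n)) :
    ColBound (cutWeight G κ f) (dress G c M) (2 * (opNorm M * Real.exp (2 * κ * S.card)) *
      ((if f ∈ innerEdges G S then 1 else 0) +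
        2 * ∑ x, ‖invCutIn G S x * c x‖ * cutWeight G κ f x)) := by
  have hC := colBound_circulantMul_invCutIn hc S
  have hC' : ColBound (cutWeight G κ f) (circulantMul (invCutIn G S) c)
    (∑ x, ‖invCutIn G S x * c x‖ * cutWeight G κ f x) := ColBound.circulant _
  have hexp := hC.exp flipWeight_nonneg flipWeight_zero (flipWeight_add hκ)
  have hexpn := hC.neg.exp flipWeight_nonneg flipWeight_zero (flipWeight_add hκ)
  have hexp' := hC.exp_leibniz flipWeight_nonneg flipWeight_zero (flipWeight_add hκ)
    (cutWeight_nonneg f) (cutWeight_zero f) (cutWeight_add hκ f) hC'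
  have hexpn' := hC.neg.exp_leibniz flipWeight_nonneg flipWeight_zero (flipWeight_add hκ)
    (cutWeight_nonneg f) (cutWeight_zero f) (cutWeight_add hκ f) hC'.neg
  have hM1 := hM.colBound_flipWeight hG hκ
  rw [dress_eq_of_commute hcomm]
  refine ((hexpn.mul flipWeight_nonneg (flipWeight_add hκ) hM1).mul_leibniz flipWeight_nonneg
    (cutWeight_nonneg f) (cutWeight_add hκ f) hexp
    (hexpn.mul_leibniz flipWeight_nonneg (cutWeight_nonneg f) (cutWeight_add hκ f) hM1 hexpn'
      (hM.colBound_cutWeight hG hκ f)) hexp').mono ?_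
  have hmain := exp_card_innerEdges_le hΔ hN hNκ (opNorm_nonneg M) S
  have hp : 0 ≤ ∑ x, ‖invCutIn G S x * c x‖ * cutWeight G κ f x := hC'.nonneg (cutWeight_nonneg f)
  generalize (∑ x, ‖invCutIn G S x * c x‖ * cutWeight G κ f x) = p at hp ⊢
  refine le_trans (le_of_eq ?_) (mul_le_mul_of_nonneg_right hmain
    (by split_ifs <;> positivity : (0 : ℝ) ≤ (if f ∈ innerEdges G S then 1 else 0) + 2 * p))
  split_ifs <;> ring

end Dressing

/-! ### Bounds on the dressed perturbation -/

/-- The total weight of the terms supported in `S`. -/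
def termWeight {n : ℕ}
    (VF : Finset (Fin n) → Finset (Sym2 (Fin n)) → Matrix (F2vec n) (F2vec n) ℂ) (κ : ℝ)
    (S : Finset (Fin n)) : ℝ :=
  ∑ s, opNorm (VF S s) * Real.exp (2 * κ * S.card)

/-- A presentation of a perturbation by strongly supported terms which commute with all flips
cutting no edge inside their support, with `2 * κ`-norm at most `ε`. -/
structure IsSymmetricPresentation {n : ℕ} (G : SimpleGraph (Fin n)) [DecidableRel G.Adj]
    (VF : Finset (Fin n) → Finset (Sym2 (Fin n)) → Matrix (F2vec n) (F2vec n) ℂ)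
    (κ ε : ℝ) : Prop where
  supported : ∀ S s, VF S s ≠ 0 → IsingStronglySupported G (VF S s) S s
  nonempty : ∀ S s, VF S s ≠ 0 → S.Nonempty
  commute : ∀ S s y, Disjoint (cut G y) (innerEdges G S) → Commute (shiftMatrix y) (VF S s)
  sum_le : ∀ i, ∑ S ∈ Finset.univ.filter (fun S : Finset (Fin n) => i ∈ S),
    termWeight VF κ S ≤ ε

section Presentation

variable {n : ℕ} {G : SimpleGraph (Fin n)} [DecidableRel G.Adj]
  {VF : Finset (Fin n) → Finset (Sym2 (Fin n)) → Matrix (F2vec n) (F2vec n) ℂ} {κ ε N : ℝ}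
  {c : F2vec n → ℂ} {Δ : ℕ}

theorem opNorm_zero : opNorm (0 : Matrix (F2vec n) (F2vec n) ℂ) = 0 := by
  simp [opNorm]

theorem termWeight_nonneg (S : Finset (Fin n)) : 0 ≤ termWeight VF κ S :=
  Finset.sum_nonneg fun _ _ => mul_nonneg (opNorm_nonneg _) (Real.exp_pos _).le

theorem dress_zero : dress G c 0 = 0 := by simp [dress]

theorem dress_add (M M' : Matrix (F2vec n) (F2vec n) ℂ) :
    dress G c (M + M') = dress G c M + dress G c M' := by
  simp [dress, mul_add, add_mul]

theorem dress_sub (M M' : Matrix (F2vec n) (F2vec n) ℂ) :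
    dress G c (M - M') = dress G c M - dress G c M' := by
  simp [dress, mul_sub, sub_mul]

theorem dress_smul (z : ℂ) (M : Matrix (F2vec n) (F2vec n) ℂ) :
    dress G c (z • M) = z • dress G c M := by
  simp [dress]

theorem dress_one : dress G c 1 = 1 := by
  rw [dress, mul_one, Matrix.exp_neg_mul_exp]

theorem dress_sum {ι : Type*} (t : Finset ι) (M : ι → Matrix (F2vec n) (F2vec n) ℂ) :
    dress G c (∑ i ∈ t, M i) = ∑ i ∈ t, dress G c (M i) := by
  simp [dress, Finset.mul_sum, Finset.sum_mul]

namespace IsSymmetricPresentation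

theorem eps_nonneg (h : IsSymmetricPresentation G VF κ ε) (hn : 0 < n) : 0 ≤ ε :=
  (Finset.sum_nonneg fun S _ => termWeight_nonneg S).trans (h.sum_le ⟨0, hn⟩)

theorem sum_termWeight_mul_le (h : IsSymmetricPresentation G VF κ ε) {g : Sym2 (Fin n) → ℝ}
    (hg : ∀ e, 0 ≤ g e) :
    ∑ S, termWeight VF κ S * ∑ e ∈ innerEdges G S, g e ≤ ε * ∑ e ∈ G.edgeFinset, g e := by
  have h1 : ∀ S, termWeight VF κ S * ∑ e ∈ innerEdges G S, g e =
      ∑ e ∈ G.edgeFinset, (if ∀ i ∈ e, i ∈ S then termWeight VF κ S else 0) * g e := by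
    intro S
    rw [innerEdges, Finset.sum_filter, Finset.mul_sum]
    refine Finset.sum_congr rfl fun e _ => ?_
    split_ifs <;> simp
  rw [Finset.sum_congr rfl fun S _ => h1 S, Finset.sum_comm, Finset.mul_sum]
  refine Finset.sum_le_sum fun e _ => ?_
  rw [← Finset.sum_mul]
  refine mul_le_mul_of_nonneg_right ?_ (hg e)
  induction e with | _ i j =>
  refine le_trans ?_ (h.sum_le i)
  rw [Finset.sum_filter]
  refine Finset.sum_le_sum fun S _ => ?_
  split_ifs with h2 h3 h3
  · exact le_rfl
  · exact absurd (h2 i (by simp)) h3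
  · exact termWeight_nonneg S
  · exact le_rfl

theorem sum_termWeight_le (h : IsSymmetricPresentation G VF κ ε) :
    ∑ S, termWeight VF κ S ≤ n * ε := by
  calc ∑ S, termWeight VF κ S
      ≤ ∑ S, ∑ i, if i ∈ S then termWeight VF κ S else 0 := by
        refine Finset.sum_le_sum fun S _ => ?_
        rcases S.eq_empty_or_nonempty with rfl | ⟨i, hi⟩
        · refine le_of_eq (Eq.trans (Finset.sum_eq_zero fun s _ => ?_) (by simp))
          have : VF ∅ s = 0 := by
            by_contra hne
            simpa using h.nonempty _ _ hne
          rw [this, opNorm_zero, zero_mul]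
        · refine le_trans (by rw [if_pos hi]) (Finset.single_le_sum (fun j _ => ?_)
            (Finset.mem_univ i))
          split_ifs
          exacts [termWeight_nonneg S, le_rfl]
    _ = ∑ i, ∑ S, if i ∈ S then termWeight VF κ S else 0 := Finset.sum_comm
    _ ≤ ∑ _i : Fin n, ε := by
        refine Finset.sum_le_sum fun i _ => ?_
        rw [← Finset.sum_filter]
        exact h.sum_le i
    _ = n * ε := by simp

theorem commute_sum (h : IsSymmetricPresentation G VF κ ε) {S : Finset (Fin n)} {y : F2vec n}
    (hy : Disjoint (cut G y) (innerEdges G S)) : Commute (shiftMatrix y) (∑ s, VF S s) :=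
  Commute.sum_right _ _ _ fun s _ => h.commute S s y hy

theorem colBound_dress (h : IsSymmetricPresentation G VF κ ε) (hG : G.Connected)
    (hΔ : ∀ i, G.degree i ≤ Δ) (hκ : 0 ≤ κ) (hN : 0 ≤ N) (hNκ : 2 * Δ * N ≤ κ)
    (hc : ∀ e, ∑ x, cutWeight G κ e x * ‖c x‖ ≤ N) (S : Finset (Fin n)) :
    ColBound (flipWeight κ) (dress G c (∑ s, VF S s)) (2 * termWeight VF κ S) := by
  rw [dress_sum, termWeight, Finset.mul_sum]
  refine ColBound.sum flipWeight_nonneg _ fun s _ => ?_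
  by_cases h0 : VF S s = 0
  · rw [h0, dress_zero, opNorm_zero, zero_mul, mul_zero]
    exact ColBound.zero
  · exact _root_.colBound_dress hG hΔ hκ hN hNκ hc (h.supported S s h0) (h.commute S s)

theorem colBound_dress_cutWeight (h : IsSymmetricPresentation G VF κ ε) (hG : G.Connected)
    (hΔ : ∀ i, G.degree i ≤ Δ) (hκ : 0 ≤ κ) (hN : 0 ≤ N) (hNκ : 2 * Δ * N ≤ κ)
    (hc : ∀ e, ∑ x, cutWeight G κ e x * ‖c x‖ ≤ N) (f : Sym2 (Fin n)) (S : Finset (Fin n)) :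
    ColBound (cutWeight G κ f) (dress G c (∑ s, VF S s)) (2 * termWeight VF κ S *
      ((if f ∈ innerEdges G S then 1 else 0) +
        2 * ∑ x, ‖invCutIn G S x * c x‖ * cutWeight G κ f x)) := by
  rw [dress_sum, termWeight, Finset.mul_sum, Finset.sum_mul]
  refine ColBound.sum (cutWeight_nonneg f) _ fun s _ => ?_
  by_cases h0 : VF S s = 0
  · rw [h0, dress_zero, opNorm_zero, zero_mul, mul_zero, zero_mul]
    exact ColBound.zero
  · exact _root_.colBound_dress_cutWeight hG hΔ hκ hN hNκ hc (h.supported S s h0)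
      (h.commute S s) f

theorem colBound_dress_sum_cutWeight (h : IsSymmetricPresentation G VF κ ε) (hG : G.Connected)
    (hn : 0 < n) (hΔ : ∀ i, G.degree i ≤ Δ) (hκ : 0 ≤ κ) (hN : 0 ≤ N) (hNκ : 2 * Δ * N ≤ κ)
    (hc : ∀ e, ∑ x, cutWeight G κ e x * ‖c x‖ ≤ N) (f : Sym2 (Fin n)) :
    ColBound (cutWeight G κ f) (dress G c (∑ S, ∑ s, VF S s)) (2 * ε + 4 * ε * N) := by
  have hε := h.eps_nonneg hn
  rw [dress_sum]
  refine (ColBound.sum (cutWeight_nonneg f) _ fun S _ =>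
    h.colBound_dress_cutWeight hG hΔ hκ hN hNκ hc f S).mono ?_
  set p : Sym2 (Fin n) → ℝ := fun e => ∑ x, ‖invCutAt G e x * c x‖ * cutWeight G κ f x with hp
  have hp0 : ∀ e, 0 ≤ p e := fun e =>
    Finset.sum_nonneg fun x _ => mul_nonneg (norm_nonneg _) (cutWeight_nonneg f x)
  have h1 : ∀ S, (if f ∈ innerEdges G S then (1 : ℝ) else 0) =
      ∑ e ∈ innerEdges G S, if e = f then 1 else 0 := fun S => by
    rw [Finset.sum_ite_eq']
  have h2 : ∀ S, ∑ x, ‖invCutIn G S x * c x‖ * cutWeight G κ f x ≤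
      ∑ e ∈ innerEdges G S, p e := fun S => by
    rw [hp, Finset.sum_comm]
    refine Finset.sum_le_sum fun x _ => ?_
    simp only [norm_mul]
    rw [← Finset.sum_mul, ← Finset.sum_mul]
    exact mul_le_mul_of_nonneg_right (mul_le_mul_of_nonneg_right (norm_invCutIn_le S x)
      (norm_nonneg _)) (cutWeight_nonneg f x)
  have h3 := h.sum_termWeight_mul_le (g := fun e => if e = f then 1 else 0)
    fun e => by split_ifs <;> norm_num
  have h4 := h.sum_termWeight_mul_le hp0
  have h5 : ∑ e ∈ G.edgeFinset, (if e = f then (1 : ℝ) else 0) ≤ 1 := by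
    rw [Finset.sum_ite_eq']
    split_ifs <;> norm_num
  have h6 : ∑ e ∈ G.edgeFinset, p e ≤ N := sum_norm_invCutAt_le hc f
  calc _ ≤ ∑ S, (2 * (termWeight VF κ S * ∑ e ∈ innerEdges G S, if e = f then 1 else 0) +
          4 * (termWeight VF κ S * ∑ e ∈ innerEdges G S, p e)) := by
        refine Finset.sum_le_sum fun S _ => ?_
        rw [h1]
        have := mul_le_mul_of_nonneg_left (h2 S) (termWeight_nonneg (VF := VF) (κ := κ) S)
        linarith
    _ ≤ 2 * (ε * 1) + 4 * (ε * N) := by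
        rw [Finset.sum_add_distrib, ← Finset.mul_sum, ← Finset.mul_sum]
        have := mul_le_mul_of_nonneg_left h5 hε
        have := mul_le_mul_of_nonneg_left h6 hε
        linarith
    _ = 2 * ε + 4 * ε * N := by ring

theorem colBound_dressRemainder (h : IsSymmetricPresentation G VF κ ε) (hG : G.Connected)
    (hn : 0 < n) (hΔ : ∀ i, G.degree i ≤ Δ) (hκ : 0 ≤ κ) (hN : 0 ≤ N) (hNκ : 2 * Δ * N ≤ κ)
    (hc : ∀ e, ∑ x, cutWeight G κ e x * ‖c x‖ ≤ N) (f : Sym2 (Fin n)) :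
    ColBound (cutWeight G κ f) (dressRemainder G (∑ S, ∑ s, VF S s) c)
      (N * (Real.exp (2 * N) - 1) + (2 * ε + 4 * ε * N)) := by
  refine ColBound.add (cutWeight_nonneg f) (ColBound.neg ?_)
    (h.colBound_dress_sum_cutWeight hG hn hΔ hκ hN hNκ hc f)
  have hterm : ∀ e, ColBound (cutWeight G κ f) (Matrix.diagonal (cutSign G e) *
      (NormedSpace.exp ((2 : ℂ) • circulantMul (invCutAt G e) c) - 1 -
        (2 : ℂ) • circulantMul (invCutAt G e) c))
      (2 * (∑ x, ‖invCutAt G e x * c x‖ * cutWeight G κ f x) * (Real.exp (2 * N) - 1)) := by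
    intro e
    refine ColBound.diagonal_mul (cutWeight_nonneg f) (fun a => (norm_cutSign e a).le) ?_
    have hA := (colBound_circulantMul_invCutAt hc e).smul 2
    have hA' : ColBound (cutWeight G κ f) (circulantMul (invCutAt G e) c)
      (∑ x, ‖invCutAt G e x * c x‖ * cutWeight G κ f x) := ColBound.circulant _
    have := ColBound.exp_sub_one_sub flipWeight_nonneg flipWeight_zero (flipWeight_add hκ)
      (cutWeight_nonneg f) (cutWeight_add hκ f) hA (hA'.smul 2)
    simpa using this
  refine ((ColBound.sum (cutWeight_nonneg f) _ fun e _ => hterm e).smul _).mono ?_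
  rw [← Finset.sum_mul, ← Finset.mul_sum]
  have h0 : 0 ≤ Real.exp (2 * N) - 1 := by
    have := Real.one_le_exp (x := 2 * N) (by positivity)
    linarith
  have := mul_le_mul_of_nonneg_right (sum_norm_invCutAt_le hc f) h0
  simp only [norm_inv, Complex.norm_ofNat]
  linarith

theorem sum_cutWeight_mul_norm_dressMap_le (h : IsSymmetricPresentation G VF κ ε)
    (hG : G.Connected) (hn : 0 < n) (hΔ : ∀ i, G.degree i ≤ Δ) (hκ : 0 ≤ κ) (hN : 0 ≤ N)
    (hNκ : 2 * Δ * N ≤ κ) (hc : ∀ e, ∑ x, cutWeight G κ e x * ‖c x‖ ≤ N) (f : Sym2 (Fin n)) :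
    ∑ x, cutWeight G κ f x * ‖dressMap G (∑ S, ∑ s, VF S s) c x‖ ≤
      N * (Real.exp (2 * N) - 1) + (2 * ε + 4 * ε * N) := by
  refine (Finset.sum_le_sum fun x _ => ?_).trans
    (h.colBound_dressRemainder hG hn hΔ hκ hN hNκ hc f 0)
  rw [sub_zero, mul_comm]
  refine mul_le_mul_of_nonneg_right ?_ (cutWeight_nonneg f x)
  unfold dressMap
  split_ifs <;> simp

/-- For weak perturbations the dressing can be chosen to preserve the ground space. -/
theorem exists_dressMap_eq (h : IsSymmetricPresentation G VF κ ε) (hG : G.Connected) (hn : 0 < n)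
    (hΔ : ∀ i, G.degree i ≤ Δ) (hκ : 0 ≤ κ) (hε : ε ≤ 1 / 20000)
    (hεκ : 2 * Δ * (100 * ε) ≤ κ) :
    ∃ c, dressMap G (∑ S, ∑ s, VF S s) c = c ∧
      ∀ e, ∑ x, cutWeight G κ e x * ‖c x‖ ≤ 100 * ε := by
  have hε0 := h.eps_nonneg hn
  have hzero : ∀ x, (∀ e, cutWeight G κ e x < 1) →
      ∀ c, dressMap G (∑ S, ∑ s, VF S s) c x = 0 := by
    intro x hx c
    refine if_pos (Finset.eq_empty_of_forall_notMem fun e he => ?_)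
    have := hx e
    rw [cutWeight, if_pos he] at this
    exact this.not_ge (one_le_flipWeight hκ x)
  rcases hε0.eq_or_lt with h0 | hpos
  · subst h0
    refine ⟨0, ?_, by simp⟩
    funext x
    by_cases hx : cut G x = ∅
    · simp [dressMap, hx]
    · obtain ⟨e, he⟩ := Finset.nonempty_iff_ne_empty.2 hx
      have h1 := h.sum_cutWeight_mul_norm_dressMap_le (N := 0) (c := 0) hG hn hΔ hκ le_rfl
        (by simpa using hκ) (by simp) e
      have h2 := (Finset.single_le_sum (fun y _ => mul_nonneg (cutWeight_nonneg e y)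
        (norm_nonneg _)) (Finset.mem_univ x)).trans h1
      rw [cutWeight, if_pos he] at h2
      have h3 := mul_le_mul_of_nonneg_right (one_le_flipWeight hκ x)
        (norm_nonneg (dressMap G (∑ S, ∑ s, VF S s) 0 x))
      have h4 : ‖dressMap G (∑ S, ∑ s, VF S s) 0 x‖ ≤ 0 := by linarith
      simpa using h4
  · refine exists_fixedPoint_of_weighted_bound (k := fun e x => cutWeight G κ e x)
      (fun e x => cutWeight_nonneg e x) (differentiable_dressMap _) hzero (by positivity) ?_
    intro c hc e
    refine (h.sum_cutWeight_mul_norm_dressMap_le hG hn hΔ hκ (by positivity) hεκ hc e).trans ?_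
    have hexp := Real.abs_exp_sub_one_le (x := 2 * (100 * ε))
      (by rw [abs_of_nonneg (by positivity)]; linarith)
    rw [abs_of_nonneg (a := 2 * (100 * ε)) (by positivity)] at hexp
    have h1 := (le_abs_self _).trans hexp
    have h2 := mul_le_mul_of_nonneg_left h1 (by positivity : 0 ≤ 100 * ε)
    nlinarith

end IsSymmetricPresentation

end Presentation

/-! ### The dressed Hamiltonian -/

section DressedHamiltonian

variable {n : ℕ} (G : SimpleGraph (Fin n)) [DecidableRel G.Adj]

/-- The Ising Hamiltonian, counting the cut edges. -/
def isingHam : Matrix (F2vec n) (F2vec n) ℂ := Matrix.diagonal fun x => ((cut G x).card : ℂ)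

/-- The difference between the dressed Hamiltonian and the Ising Hamiltonian. -/
def dressedPert (V : Matrix (F2vec n) (F2vec n) ℂ) (c : F2vec n → ℂ) :
    Matrix (F2vec n) (F2vec n) ℂ :=
  -((2 : ℂ)⁻¹ • ∑ e ∈ G.edgeFinset, Matrix.diagonal (cutSign G e) *
    (NormedSpace.exp ((2 : ℂ) • circulantMul (invCutAt G e) c) - 1)) + dress G c V

variable {G} {VF : Finset (Fin n) → Finset (Sym2 (Fin n)) → Matrix (F2vec n) (F2vec n) ℂ}
  {V : Matrix (F2vec n) (F2vec n) ℂ} {κ ε N : ℝ} {c : F2vec n → ℂ} {Δ : ℕ}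

theorem isingHam_eq_sum : isingHam G =
    ∑ e ∈ G.edgeFinset, (2 : ℂ)⁻¹ • (1 - Matrix.diagonal (cutSign G e)) := by
  rw [isingHam, ← ising_hamiltonian_eq_diagonal]
  exact Finset.sum_congr rfl fun e he => by rw [pauli_isingVec (G := G) he]

theorem dress_isingHam_add :
    dress G c (isingHam G + V) = isingHam G + dressedPert G V c := by
  rw [dress_add, dressedPert, ← add_assoc]
  congr 1
  rw [isingHam_eq_sum, dress_sum, Finset.smul_sum, ← Finset.sum_neg_distrib,
    ← Finset.sum_add_distrib]
  refine Finset.sum_congr rfl fun e _ => ?_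
  rw [dress_smul, dress_sub, dress_one, dress_diagonal_cutSign, mul_sub, mul_one]
  module

theorem dressedPert_eq : dressedPert G V c = dressRemainder G V c -
    ∑ e ∈ G.edgeFinset, Matrix.diagonal (cutSign G e) * circulantMul (invCutAt G e) c := by
  have h : ∀ e, Matrix.diagonal (cutSign G e) *
      (NormedSpace.exp ((2 : ℂ) • circulantMul (invCutAt G e) c) - 1) =
      Matrix.diagonal (cutSign G e) *
        (NormedSpace.exp ((2 : ℂ) • circulantMul (invCutAt G e) c) - 1 -
          (2 : ℂ) • circulantMul (invCutAt G e) c) +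
      (2 : ℂ) • (Matrix.diagonal (cutSign G e) * circulantMul (invCutAt G e) c) := by
    intro e
    rw [mul_sub _ (_ - 1), mul_smul_comm, sub_add_cancel]
  rw [dressedPert, dressRemainder, Finset.sum_congr rfl fun e _ => h e, Finset.sum_add_distrib,
    ← Finset.smul_sum]
  module

theorem dressedPert_apply_zero (hc : dressMap G V c = c) {x : F2vec n} (hx : cut G x ≠ ∅) :
    dressedPert G V c x 0 = 0 := by
  have h1 : ∀ e ∈ G.edgeFinset,
      (Matrix.diagonal (cutSign G e) * circulantMul (invCutAt G e) c) x 0 =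
        if e ∈ cut G x then -(invCut G x * c x) else 0 := by
    intro e _
    rw [Matrix.diagonal_mul]
    by_cases he : e ∈ cut G x <;>
      simp [circulantMul, Matrix.circulant_apply, invCutAt, cutSign, he]
  have h2 : c x = -dressRemainder G V c x 0 := by
    conv_lhs => rw [← hc, dressMap, if_neg hx]
  have h3 : ((cut G x).card : ℂ) ≠ 0 := by simpa using hx
  rw [dressedPert_eq, Matrix.sub_apply, Matrix.sum_apply, Finset.sum_congr rfl h1,
    Finset.sum_ite_mem, Finset.inter_eq_right.2 (cut_subset x), Finset.sum_const, nsmul_eq_mul,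
    invCut, mul_neg, ← mul_assoc, mul_inv_cancel₀ h3, h2]
  ring

theorem colBound_exp_circulantMul_sub_one (hκ : 0 ≤ κ)
    (hc : ∀ e, ∑ x, cutWeight G κ e x * ‖c x‖ ≤ N) (e : Sym2 (Fin n)) :
    ColBound (flipWeight κ) (NormedSpace.exp ((2 : ℂ) • circulantMul (invCutAt G e) c) - 1)
      (Real.exp (2 * N) - 1) := by
  have hA := (colBound_circulantMul_invCutAt hc e).smul 2
  have := ColBound.exp_sub_one flipWeight_nonneg flipWeight_zero (flipWeight_add hκ) hA
  simpa using this

namespace IsSymmetricPresentation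

theorem commute_dressedPert_flip (h : IsSymmetricPresentation G VF κ ε) (hG : G.Connected) :
    Commute (shiftMatrix fun _ => 1) (dressedPert G (∑ S, ∑ s, VF S s) c) := by
  have hcut : cut G (fun _ => 1 : F2vec n) = ∅ := (cut_eq_empty hG).2 (Or.inr rfl)
  refine Commute.add_right (Commute.neg_right ((Commute.sum_right _ _ _ fun e _ =>
    Commute.mul_right ?_ ?_).smul_right _)) ?_
  · rw [commute_shiftMatrix_iff]
    intro a b
    simp only [Matrix.diagonal_apply, add_left_inj, cutSign_add]
    simp [cutSign, hcut]
  · exact ((commute_shiftMatrix_circulantMul _ _ c).smul_right _).exp_right.sub_right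
      (Commute.one_right _)
  · refine commute_shiftMatrix_dress (Commute.sum_right _ _ _ fun S _ => h.commute_sum ?_)
    rw [hcut]
    exact Finset.disjoint_empty_left _

theorem colBound_dressedPert (h : IsSymmetricPresentation G VF κ ε) (hG : G.Connected)
    (hΔ : ∀ i, G.degree i ≤ Δ) (hκ : 0 ≤ κ) (hN : 0 ≤ N) (hNκ : 2 * Δ * N ≤ κ)
    (hc : ∀ e, ∑ x, cutWeight G κ e x * ‖c x‖ ≤ N) :
    ColBound (flipWeight κ) (dressedPert G (∑ S, ∑ s, VF S s) c)
      (Δ * n * (Real.exp (2 * N) - 1) / 2 + 2 * (n * ε)) := by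
  refine ColBound.add flipWeight_nonneg (ColBound.neg ?_) ?_
  · refine ((ColBound.sum flipWeight_nonneg _ fun e _ => ColBound.diagonal_mul flipWeight_nonneg
      (fun a => (norm_cutSign e a).le) (colBound_exp_circulantMul_sub_one hκ hc e)).smul _).mono ?_
    rw [Finset.sum_const, nsmul_eq_mul]
    have h0 : 0 ≤ Real.exp (2 * N) - 1 := by
      have := Real.one_le_exp (x := 2 * N) (by positivity)
      linarith
    have := mul_le_mul_of_nonneg_right (card_edgeFinset_le hΔ) h0
    simp only [norm_inv, Complex.norm_ofNat]
    linarith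
  · rw [dress_sum]
    refine (ColBound.sum flipWeight_nonneg _ fun S _ =>
      h.colBound_dress hG hΔ hκ hN hNκ hc S).mono ?_
    rw [← Finset.mul_sum]
    linarith [h.sum_termWeight_le]

theorem norm_dressedPert_flip_le (h : IsSymmetricPresentation G VF κ ε) (hG : G.Connected)
    (hΔ : ∀ i, G.degree i ≤ Δ) (hκ : 0 ≤ κ) (hN : 0 ≤ N) (hNκ : 2 * Δ * N ≤ κ)
    (hc : ∀ e, ∑ x, cutWeight G κ e x * ‖c x‖ ≤ N) :
    ‖dressedPert G (∑ S, ∑ s, VF S s) c (fun _ => 1) 0‖ ≤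
      (Δ * n * (Real.exp (2 * N) - 1) / 2 + 2 * (n * ε)) * Real.exp (-(κ * n)) := by
  have h1 := (Finset.single_le_sum (fun a _ => mul_nonneg (norm_nonneg _) (flipWeight_nonneg _))
    (Finset.mem_univ (fun _ => 1 : F2vec n))).trans
      (h.colBound_dressedPert hG hΔ hκ hN hNκ hc 0)
  rw [sub_zero, flipWeight_one] at h1
  rwa [Real.exp_neg, ← div_eq_mul_inv, le_div_iff₀ (Real.exp_pos _)]

theorem sum_norm_dress_sub_le (h : IsSymmetricPresentation G VF κ ε) (hG : G.Connected)
    (hΔ : ∀ i, G.degree i ≤ Δ) (hκ : 0 ≤ κ) (hN : 0 ≤ N) (hNκ : 2 * Δ * N ≤ κ)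
    (hc : ∀ e, ∑ x, cutWeight G κ e x * ‖c x‖ ≤ N) (b : F2vec n) (S : Finset (Fin n)) :
    ∑ a, ‖dress G c (∑ s, VF S s) a b - dress G c (∑ s, VF S s) (a - b) 0‖ ≤
      4 * (termWeight VF κ S * ∑ e ∈ innerEdges G S, if e ∈ cut G b then 1 else 0) := by
  by_cases hb : Disjoint (cut G b) (innerEdges G S)
  · have h1 := commute_shiftMatrix_iff.1 (commute_shiftMatrix_dress (G := G) (c := c)
      (h.commute_sum hb))
    refine le_trans (le_of_eq (Finset.sum_eq_zero fun a _ => ?_)) (mul_nonneg (by norm_num)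
      (mul_nonneg (termWeight_nonneg S) (Finset.sum_nonneg fun e _ => by split_ifs <;> norm_num)))
    have := h1 (a - b) 0
    rw [sub_add_cancel, zero_add] at this
    rw [this, sub_self, norm_zero]
  · have hcol : ∀ d, ∑ a, ‖dress G c (∑ s, VF S s) a d‖ ≤ 2 * termWeight VF κ S := fun d =>
      (Finset.sum_le_sum fun a _ => le_mul_of_one_le_right (norm_nonneg _)
        (one_le_flipWeight hκ (a - d))).trans (h.colBound_dress hG hΔ hκ hN hNκ hc S d)
    obtain ⟨e, he, he'⟩ := Finset.not_disjoint_iff.1 hb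
    have h1 : (1 : ℝ) ≤ ∑ e ∈ innerEdges G S, if e ∈ cut G b then 1 else 0 :=
      le_trans (by rw [if_pos he]) (Finset.single_le_sum
        (f := fun e => if e ∈ cut G b then (1 : ℝ) else 0)
        (fun e _ => by split_ifs <;> norm_num) he')
    have h2 := le_mul_of_one_le_right (termWeight_nonneg (VF := VF) (κ := κ) S) h1
    have h3 : ∑ a, ‖dress G c (∑ s, VF S s) (a - b) 0‖ = ∑ a, ‖dress G c (∑ s, VF S s) a 0‖ :=
      Equiv.sum_comp (Equiv.subRight b) fun x => ‖dress G c (∑ s, VF S s) x 0‖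
    calc _ ≤ ∑ a, (‖dress G c (∑ s, VF S s) a b‖ + ‖dress G c (∑ s, VF S s) (a - b) 0‖) :=
          Finset.sum_le_sum fun a _ => norm_sub_le _ _
      _ ≤ _ := by
          rw [Finset.sum_add_distrib, h3]
          linarith [hcol b, hcol 0]

theorem sum_norm_diagonal_mul_sub_le (hκ : 0 ≤ κ)
    (hc : ∀ e, ∑ x, cutWeight G κ e x * ‖c x‖ ≤ N) (b : F2vec n) (e : Sym2 (Fin n)) :
    ∑ a, ‖(Matrix.diagonal (cutSign G e) *
          (NormedSpace.exp ((2 : ℂ) • circulantMul (invCutAt G e) c) - 1)) a b -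
        (Matrix.diagonal (cutSign G e) *
          (NormedSpace.exp ((2 : ℂ) • circulantMul (invCutAt G e) c) - 1)) (a - b) 0‖ ≤
      if e ∈ cut G b then 2 * (Real.exp (2 * N) - 1) else 0 := by
  have hcomm : Commute (shiftMatrix b)
      (NormedSpace.exp ((2 : ℂ) • circulantMul (invCutAt G e) c) - 1) :=
    ((commute_shiftMatrix_circulantMul _ _ c).smul_right _).exp_right.sub_right
      (Commute.one_right _)
  have hcol := colBound_exp_circulantMul_sub_one hκ hc e b
  generalize NormedSpace.exp ((2 : ℂ) • circulantMul (invCutAt G e) c) - 1 = X at hcomm hcol ⊢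
  have hX : ∀ a, X (a - b) 0 = X a b := fun a => by
    have := commute_shiftMatrix_iff.1 hcomm (a - b) 0
    rwa [sub_add_cancel, zero_add, eq_comm] at this
  have hsign : ∀ a, cutSign G e a = cutSign G e (a - b) * cutSign G e b := fun a => by
    rw [← cutSign_add, sub_add_cancel]
  have hterm : ∀ a, (Matrix.diagonal (cutSign G e) * X) a b -
      (Matrix.diagonal (cutSign G e) * X) (a - b) 0 =
        cutSign G e (a - b) * (cutSign G e b - 1) * X a b := fun a => by
    rw [Matrix.diagonal_mul, Matrix.diagonal_mul, hX, hsign a]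
    ring
  simp only [hterm]
  split_ifs with he
  · refine le_trans ?_ (mul_le_mul_of_nonneg_left hcol zero_le_two)
    rw [Finset.mul_sum]
    refine Finset.sum_le_sum fun a _ => ?_
    have h2 : ‖cutSign G e b - 1‖ = 2 := by
      rw [cutSign, if_pos he]
      norm_num
    rw [norm_mul, norm_mul, norm_cutSign, one_mul, h2]
    exact mul_le_mul_of_nonneg_left
      (le_mul_of_one_le_right (norm_nonneg _) (one_le_flipWeight hκ _)) zero_le_two
  · refine le_of_eq (Finset.sum_eq_zero fun a _ => ?_)
    simp [cutSign, he]

/-- The dressed perturbation is translation invariant up to an error of the order of the number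
of cut edges. -/
theorem sum_norm_dressedPert_sub_le (h : IsSymmetricPresentation G VF κ ε) (hG : G.Connected)
    (hΔ : ∀ i, G.degree i ≤ Δ) (hκ : 0 ≤ κ) (hN : 0 ≤ N) (hNκ : 2 * Δ * N ≤ κ)
    (hc : ∀ e, ∑ x, cutWeight G κ e x * ‖c x‖ ≤ N) (b : F2vec n) :
    ∑ a, ‖dressedPert G (∑ S, ∑ s, VF S s) c a b -
        dressedPert G (∑ S, ∑ s, VF S s) c (a - b) 0‖ ≤
      (cut G b).card * ((Real.exp (2 * N) - 1) + 4 * ε) := by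
  set X : Sym2 (Fin n) → Matrix (F2vec n) (F2vec n) ℂ := fun e => Matrix.diagonal (cutSign G e) *
    (NormedSpace.exp ((2 : ℂ) • circulantMul (invCutAt G e) c) - 1) with hX
  have hval : ∀ a d, dressedPert G (∑ S, ∑ s, VF S s) c a d =
      -(2⁻¹ * ∑ e ∈ G.edgeFinset, X e a d) + ∑ S, dress G c (∑ s, VF S s) a d := fun a d => by
    rw [dressedPert, dress_sum, Matrix.add_apply, Matrix.neg_apply, Matrix.smul_apply,
      Matrix.sum_apply, Matrix.sum_apply, smul_eq_mul]
  have hpt : ∀ a, ‖dressedPert G (∑ S, ∑ s, VF S s) c a b -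
      dressedPert G (∑ S, ∑ s, VF S s) c (a - b) 0‖ ≤
        2⁻¹ * ∑ e ∈ G.edgeFinset, ‖X e a b - X e (a - b) 0‖ +
        ∑ S, ‖dress G c (∑ s, VF S s) a b - dress G c (∑ s, VF S s) (a - b) 0‖ := fun a => by
    have hsplit : dressedPert G (∑ S, ∑ s, VF S s) c a b -
        dressedPert G (∑ S, ∑ s, VF S s) c (a - b) 0 =
          -(2⁻¹ * ∑ e ∈ G.edgeFinset, (X e a b - X e (a - b) 0)) +
          ∑ S, (dress G c (∑ s, VF S s) a b - dress G c (∑ s, VF S s) (a - b) 0) := by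
      rw [hval, hval, Finset.sum_sub_distrib, Finset.sum_sub_distrib]
      ring
    rw [hsplit]
    refine (norm_add_le _ _).trans (add_le_add ?_ (norm_sum_le _ _))
    rw [norm_neg, norm_mul, norm_inv, Complex.norm_ofNat]
    exact mul_le_mul_of_nonneg_left (norm_sum_le _ _) (by norm_num)
  refine (Finset.sum_le_sum fun a _ => hpt a).trans ?_
  rw [Finset.sum_add_distrib, ← Finset.mul_sum, Finset.sum_comm, Finset.sum_comm (s := Finset.univ)
    (t := Finset.univ)]
  have h1 : ∑ e ∈ G.edgeFinset, ∑ a, ‖X e a b - X e (a - b) 0‖ ≤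
      (cut G b).card * (2 * (Real.exp (2 * N) - 1)) := by
    refine (Finset.sum_le_sum fun e _ => sum_norm_diagonal_mul_sub_le hκ hc b e).trans ?_
    rw [Finset.sum_ite_mem, Finset.inter_eq_right.2 (cut_subset b), Finset.sum_const,
      nsmul_eq_mul]
  have h2 : ∑ S, ∑ a, ‖dress G c (∑ s, VF S s) a b - dress G c (∑ s, VF S s) (a - b) 0‖ ≤
      4 * (ε * (cut G b).card) := by
    refine (Finset.sum_le_sum fun S _ => h.sum_norm_dress_sub_le hG hΔ hκ hN hNκ hc b S).trans ?_
    rw [← Finset.mul_sum]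
    refine mul_le_mul_of_nonneg_left ((h.sum_termWeight_mul_le
      fun e => by split_ifs <;> norm_num).trans (le_of_eq ?_)) (by norm_num)
    rw [Finset.sum_ite_mem, Finset.inter_eq_right.2 (cut_subset b), Finset.sum_const,
      nsmul_eq_mul, mul_one]
  linarith

end IsSymmetricPresentation

end DressedHamiltonian

/-! ### The spectrum of the dressed Hamiltonian -/

theorem Matrix.charpoly_eq_mul_toSquareBlockProp {Γ : Type*} [Fintype Γ] [DecidableEq Γ]
    (M : Matrix Γ Γ ℂ) (p : Γ → Prop) [DecidablePred p]
    (h : ∀ i, ¬p i → ∀ j, p j → M i j = 0) :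
    M.charpoly = (M.toSquareBlockProp p).charpoly *
      (M.toSquareBlockProp fun i => ¬p i).charpoly := by
  have hblock : ∀ q : Γ → Prop, M.charmatrix.toSquareBlockProp q =
      (M.toSquareBlockProp q).charmatrix := by
    intro q
    ext1 i j
    by_cases hij : i = j
    · simp [hij, Matrix.toSquareBlockProp_def]
    · simp [hij, Matrix.toSquareBlockProp_def, Subtype.coe_ne_coe.2 hij]
  rw [Matrix.charpoly, M.charmatrix.twoBlockTriangular_det p, hblock, hblock, Matrix.charpoly,
    Matrix.charpoly]
  · congr!
  · intro i hi j hj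
    have hij : i ≠ j := fun hij => hi (hij ▸ hj)
    rw [Matrix.charmatrix_apply_ne _ _ _ hij, h i hi j hj, map_zero, neg_zero]

section Spectrum

variable {n : ℕ} {G : SimpleGraph (Fin n)} [DecidableRel G.Adj]

theorem charpoly_toSquareBlockProp_cut (hG : G.Connected) (hn : 0 < n)
    {K : Matrix (F2vec n) (F2vec n) ℂ} (hflip : Commute (shiftMatrix fun _ => 1) K) :
    (K.toSquareBlockProp fun x => cut G x = ∅).charpoly =
      (Polynomial.X - Polynomial.C (K 0 0 + K (fun _ => 1) 0)) *
        (Polynomial.X - Polynomial.C (K 0 0 - K (fun _ => 1) 0)) := by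
  have h0 : cut G (0 : F2vec n) = ∅ := cut_zero
  have h1 : cut G (fun _ => 1 : F2vec n) = ∅ := (cut_eq_empty hG).2 (Or.inr rfl)
  have hne := F2vec.one_ne_zero hn
  have hbij : Function.Bijective
      (![⟨0, h0⟩, ⟨fun _ => 1, h1⟩] : Fin 2 → {x : F2vec n // cut G x = ∅}) := by
    constructor
    · intro i j hij
      fin_cases i <;> fin_cases j <;> simp_all [Subtype.ext_iff, eq_comm]
    · rintro ⟨x, hx⟩
      rcases (cut_eq_empty hG).1 hx with rfl | rfl
      · exact ⟨0, rfl⟩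
      · exact ⟨1, rfl⟩
  rw [← Matrix.charpoly_reindex (Equiv.ofBijective _ hbij).symm]
  have hK := commute_shiftMatrix_iff.1 hflip
  have h11 : K (fun _ => 1) (fun _ => 1) = K 0 0 := by simpa using hK 0 0
  have h01 : K 0 (fun _ => 1) = K (fun _ => 1) 0 := by
    have h2 : ((fun _ => 1) + fun _ => 1 : F2vec n) = 0 := by
      rw [← F2vec.sub_eq_add, sub_self]
    have := hK (fun _ => 1) 0
    rwa [h2, zero_add] at this
  have hentries : Matrix.reindex (Equiv.ofBijective _ hbij).symm (Equiv.ofBijective _ hbij).symm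
      (K.toSquareBlockProp fun x => cut G x = ∅) =
        !![K 0 0, K (fun _ => 1) 0; K (fun _ => 1) 0, K 0 0] := by
    ext i j
    fin_cases i <;> fin_cases j
    exacts [rfl, h01, rfl, h11]
  rw [hentries, Matrix.charpoly, Matrix.det_fin_two]
  simp
  ring

theorem le_re_of_isRoot_charpoly {T : Matrix (F2vec n) (F2vec n) ℂ} (hG : G.Connected)
    {δ : ℝ} (hδ : δ ≤ 1)
    (hT : ∀ x, cut G x ≠ ∅ → T x 0 = 0)
    (hsub : ∀ b, ∑ a, ‖T a b - T (a - b) 0‖ ≤ (cut G b).card * δ) {z t : ℂ}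
    (ht : ((isingHam G + T - z • (1 : Matrix (F2vec n) (F2vec n) ℂ)).toSquareBlockProp
      fun x => ¬cut G x = ∅).charpoly.IsRoot t) :
    1 - δ - ‖T (fun _ => 1) 0‖ ≤ (t + z - T 0 0).re := by
  by_contra hlt
  rw [Polynomial.IsRoot, Matrix.eval_charpoly] at ht
  refine det_ne_zero_of_sum_col_lt_diag ?_ ht
  rintro ⟨b, hb⟩
  have hcard : (1 : ℝ) ≤ (cut G b).card := by
    exact_mod_cast Finset.card_pos.2 (Finset.nonempty_iff_ne_empty.2 hb)
  have hoff : ∀ a, a ≠ b → ‖T a b‖ ≤ ‖T a b - T (a - b) 0‖ +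
      if a = b + (fun _ => 1) then ‖T (fun _ => 1) 0‖ else 0 := by
    intro a hab
    have h1 : ‖T a b‖ ≤ ‖T a b - T (a - b) 0‖ + ‖T (a - b) 0‖ := by
      simpa using norm_add_le (T a b - T (a - b) 0) (T (a - b) 0)
    refine h1.trans (add_le_add_right ?_ _)
    by_cases hc : cut G (a - b) = ∅
    · rcases (cut_eq_empty hG).1 hc with h2 | h2
      · exact absurd (sub_eq_zero.1 h2) hab
      · rw [if_pos (by rw [← h2, add_sub_cancel]), h2]
    · rw [hT _ hc, norm_zero]
      split_ifs
      exacts [norm_nonneg _, le_rfl]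
  have hsum : ∑ a ∈ Finset.univ.erase b, ‖T a b‖ ≤
      (cut G b).card * δ - ‖T b b - T 0 0‖ + ‖T (fun _ => 1) 0‖ := by
    refine (Finset.sum_le_sum fun a ha => hoff a (Finset.ne_of_mem_erase ha)).trans ?_
    rw [Finset.sum_add_distrib]
    refine add_le_add ?_ ?_
    · rw [le_sub_iff_add_le]
      refine le_trans (le_of_eq ?_) (hsub b)
      rw [← Finset.sum_erase_add _ _ (Finset.mem_univ b), sub_self]
    · rw [Finset.sum_ite_eq']
      split_ifs
      exacts [le_rfl, norm_nonneg _]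
  have hdiag : (cut G b).card - ‖T b b - T 0 0‖ - (t + z - T 0 0).re ≤
      ‖t - ((cut G b).card + T b b - z)‖ := by
    have h1 := (Complex.re_le_norm (-(t - ((cut G b).card + T b b - z))))
    have h2 := (Complex.re_le_norm (-(T b b - T 0 0)))
    rw [norm_neg] at h1 h2
    simp only [Complex.neg_re, Complex.sub_re, Complex.add_re, Complex.natCast_re] at h1 h2 ⊢
    linarith
  set A : Matrix {x : F2vec n // ¬cut G x = ∅} {x : F2vec n // ¬cut G x = ∅} ℂ :=
    Matrix.scalar _ t - (isingHam G + T - z • (1 : Matrix (F2vec n) (F2vec n) ℂ)).toSquareBlockProp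
      fun x => ¬cut G x = ∅ with hA
  have hval : A ⟨b, hb⟩ ⟨b, hb⟩ = t - ((cut G b).card + T b b - z) := by
    simp [hA, Matrix.toSquareBlockProp_def, isingHam]
  have hterm : ∀ i ∈ Finset.univ.erase (⟨b, hb⟩ : {x : F2vec n // ¬cut G x = ∅}),
      ‖A i ⟨b, hb⟩‖ = ‖T i b‖ := by
    intro i hi
    have hib := Finset.ne_of_mem_erase hi
    have hib' : (i : F2vec n) ≠ b := fun h => hib (Subtype.ext h)
    simp [hA, Matrix.toSquareBlockProp_def, isingHam, Matrix.diagonal_apply, hib, hib',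
      Matrix.one_apply]
  have hleft : ∑ i ∈ Finset.univ.erase (⟨b, hb⟩ : {x : F2vec n // ¬cut G x = ∅}),
      ‖T i b‖ ≤ ∑ a ∈ Finset.univ.erase b, ‖T a b‖ := by
    refine (Finset.sum_map (Finset.univ.erase ⟨b, hb⟩)
      (Function.Embedding.subtype fun x : F2vec n => ¬cut G x = ∅)
      fun a => ‖T a b‖).symm.trans_le ?_
    refine Finset.sum_le_sum_of_subset_of_nonneg ?_ fun _ _ _ => norm_nonneg _
    intro a ha
    obtain ⟨i, hi, rfl⟩ := Finset.mem_map.1 ha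
    exact Finset.mem_erase.2 ⟨fun h => Finset.ne_of_mem_erase hi (Subtype.ext h),
      Finset.mem_univ _⟩
  rw [Finset.sum_congr rfl hterm, hval]
  refine (hleft.trans hsum).trans_lt ?_
  refine lt_of_lt_of_le ?_ hdiag
  push Not at hlt
  nlinarith

theorem charpoly_dress (c : F2vec n → ℂ) (M : Matrix (F2vec n) (F2vec n) ℂ) :
    (dress G c M).charpoly = M.charpoly := by
  rw [dress, Matrix.charpoly_mul_comm, ← mul_assoc]
  have := Matrix.exp_neg_mul_exp (-circulantMul (invCut G) c)
  rw [neg_neg] at this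
  rw [this, one_mul]

/-- A Hermitian matrix similar to a block triangular one with a two-dimensional almost degenerate
block and a gapped second block has exactly two low eigenvalues. -/
theorem eigenvalues_of_charpoly_eq {Γ : Type*} [Fintype Γ] [DecidableEq Γ] {M : Matrix Γ Γ ℂ}
    (hM : M.IsHermitian) {Q : Polynomial ℂ} (hQ : Q ≠ 0) {μ ν : ℂ}
    (hchar : M.charpoly = (Polynomial.X - Polynomial.C μ) * (Polynomial.X - Polynomial.C ν) * Q)
    {r : ℝ} (hμ : |μ.re| ≤ r) (hν : |ν.re| ≤ r) (hroots : ∀ t, Q.IsRoot t → 1 / 2 + r ≤ t.re) :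
    (∀ v, hM.eigenvalues v ∈ Set.Icc (-r) r ∪ Set.Ici (1 / 2 + r)) ∧
      (Finset.univ.filter fun v => hM.eigenvalues v ∈ Set.Icc (-r) r).card = 2 := by
  have hroots' : M.charpoly.roots = {μ} + {ν} + Q.roots := by
    have h1 := Polynomial.X_sub_C_ne_zero μ
    have h2 := Polynomial.X_sub_C_ne_zero ν
    rw [hchar, Polynomial.roots_mul (mul_ne_zero (mul_ne_zero h1 h2) hQ),
      Polynomial.roots_mul (mul_ne_zero h1 h2), Polynomial.roots_X_sub_C,
      Polynomial.roots_X_sub_C]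
  have hre : Finset.univ.val.map hM.eigenvalues = (({μ} + {ν} + Q.roots).map Complex.re) := by
    rw [← hroots', hM.roots_charpoly_eq_eigenvalues, Multiset.map_map]
    rfl
  rw [abs_le] at hμ hν
  have hlow : ∀ t ∈ Q.roots, ¬ t.re ∈ Set.Icc (-r) r := fun t ht hmem => by
    have := hroots t (Polynomial.isRoot_of_mem_roots ht)
    linarith [hmem.2]
  constructor
  · intro v
    have hv : hM.eigenvalues v ∈ Finset.univ.val.map hM.eigenvalues :=
      Multiset.mem_map_of_mem _ (Finset.mem_univ v)
    rw [hre, Multiset.mem_map] at hv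
    obtain ⟨t, ht, hv⟩ := hv
    rw [← hv]
    simp only [Multiset.mem_add, Multiset.mem_singleton] at ht
    rcases ht with (rfl | rfl) | ht
    · exact Or.inl hμ
    · exact Or.inl hν
    · exact Or.inr (hroots t (Polynomial.isRoot_of_mem_roots ht))
  · have hcount : (Finset.univ.filter fun v => hM.eigenvalues v ∈ Set.Icc (-r) r).card =
        (Finset.univ.val.map hM.eigenvalues).countP (· ∈ Set.Icc (-r) r) := by
      rw [Multiset.countP_map]
      rfl
    rw [hcount, hre, Multiset.map_add, Multiset.map_add, Multiset.countP_add,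
      Multiset.countP_add, Multiset.map_singleton, Multiset.map_singleton]
    have h3 : (Q.roots.map Complex.re).countP (· ∈ Set.Icc (-r) r) = 0 := by
      rw [Multiset.countP_eq_zero]
      intro t ht
      obtain ⟨u, hu, rfl⟩ := Multiset.mem_map.1 ht
      exact hlow u hu
    rw [h3]
    have hμ' : μ.re ∈ Set.Icc (-r) r := hμ
    have hν' : ν.re ∈ Set.Icc (-r) r := hν
    simp only [← Multiset.cons_zero, Multiset.countP_cons_of_pos _ hμ',
      Multiset.countP_cons_of_pos _ hν', Multiset.countP_zero]

end Spectrum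

section Stability

variable {n : ℕ} {G : SimpleGraph (Fin n)} [DecidableRel G.Adj]
  {VF : Finset (Fin n) → Finset (Sym2 (Fin n)) → Matrix (F2vec n) (F2vec n) ℂ} {κ ε : ℝ} {Δ : ℕ}

theorem isingHam_isHermitian : (isingHam G).IsHermitian :=
  Matrix.isHermitian_diagonal_of_self_adjoint _ (funext fun x => by simp)

theorem mul_exp_neg_le {κ t : ℝ} (hκ : 0 < κ) : t * Real.exp (-(κ * t)) ≤ 1 / κ := by
  rw [Real.exp_neg, ← div_eq_mul_inv, div_le_div_iff₀ (Real.exp_pos _) hκ]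
  linarith [Real.add_one_le_exp (κ * t)]

/-- The spectrum of the Ising Hamiltonian with a weak symmetric perturbation. -/
theorem IsSymmetricPresentation.exists_shift (h : IsSymmetricPresentation G VF κ ε)
    (hV : (∑ S, ∑ s, VF S s).IsHermitian) (hG : G.Connected) (hn : 0 < n)
    (hΔ : ∀ i, G.degree i ≤ Δ) (hκ : 0 < κ) (hε : ε ≤ 1 / 20000)
    (hεκ : 2 * Δ * (100 * ε) ≤ κ) (hεκ' : (200 * Δ + 2) * ε ≤ κ / 8) :
    ∃ z : ℝ, ∃ hH : (isingHam G + ∑ S, ∑ s, VF S s -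
        (z : ℂ) • (1 : Matrix (F2vec n) (F2vec n) ℂ)).IsHermitian,
      (∀ v, hH.eigenvalues v ∈
        Set.Icc (-((200 * Δ + 2) * n * ε * Real.exp (-(κ * n))))
          ((200 * Δ + 2) * n * ε * Real.exp (-(κ * n))) ∪
        Set.Ici (1 / 2 + (200 * Δ + 2) * n * ε * Real.exp (-(κ * n)))) ∧
      (Finset.univ.filter fun v => hH.eigenvalues v ∈
        Set.Icc (-((200 * Δ + 2) * n * ε * Real.exp (-(κ * n))))
          ((200 * Δ + 2) * n * ε * Real.exp (-(κ * n)))).card = 2 := by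
  have hε0 := h.eps_nonneg hn
  obtain ⟨c, hfix, hc⟩ := h.exists_dressMap_eq hG hn hΔ hκ.le hε hεκ
  have hR : 0 ≤ 100 * ε := by positivity
  set T := dressedPert G (∑ S, ∑ s, VF S s) c with hT
  have hexp : Real.exp (2 * (100 * ε)) - 1 ≤ 400 * ε := by
    have hexp := Real.abs_exp_sub_one_le (x := 2 * (100 * ε))
      (by rw [abs_of_nonneg (by positivity)]; linarith)
    rw [abs_of_nonneg (a := 2 * (100 * ε)) (by positivity)] at hexp
    linarith [(le_abs_self _).trans hexp]
  set r := (200 * Δ + 2) * n * ε * Real.exp (-(κ * n)) with hr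
  have hflipEntry : ‖T (fun _ => 1) 0‖ ≤ r := by
    refine (h.norm_dressedPert_flip_le hG hΔ hκ.le hR hεκ hc).trans ?_
    refine mul_le_mul_of_nonneg_right ?_ (Real.exp_pos _).le
    have := mul_le_mul_of_nonneg_left hexp (by positivity : (0 : ℝ) ≤ Δ * n)
    linarith
  have hr8 : r ≤ 1 / 8 := by
    calc r = (200 * Δ + 2) * ε * (n * Real.exp (-(κ * n))) := by rw [hr]; ring
      _ ≤ κ / 8 * (1 / κ) := mul_le_mul hεκ' (mul_exp_neg_le hκ) (by positivity) (by positivity)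
      _ = 1 / 8 := by field_simp
  have hzero : ∀ x, cut G x ≠ ∅ → T x 0 = 0 := fun x hx => dressedPert_apply_zero hfix hx
  have hflip := h.commute_dressedPert_flip (c := c) hG
  have hcut1 : cut G (fun _ => 1 : F2vec n) = ∅ := (cut_eq_empty hG).2 (Or.inr rfl)
  have hne := F2vec.one_ne_zero hn
  set z : ℝ := (T 0 0).re with hz
  set K := isingHam G + T - (z : ℂ) • (1 : Matrix (F2vec n) (F2vec n) ℂ) with hK
  have hKflip : Commute (shiftMatrix fun _ => 1) K := by
    refine (Commute.add_right ?_ hflip).sub_right ((Commute.one_right _).smul_right _)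
    rw [isingHam_eq_sum, commute_shiftMatrix_iff, ← isingHam_eq_sum]
    intro a b
    have hcard : cut G (a + fun _ => 1) = cut G a := by
      ext e
      induction e with | _ i j => simp [mem_cut]
    simp [isingHam, Matrix.diagonal_apply, hcard]
  have hK0 : ∀ x, cut G x ≠ ∅ → K x 0 = 0 := fun x hx => by
    have hx0 : x ≠ 0 := fun h0 => hx (h0 ▸ cut_zero)
    simp [hK, isingHam, hx0, hzero x hx]
  have hKblock : ∀ x, ¬cut G x = ∅ → ∀ y, cut G y = ∅ → K x y = 0 := by
    intro x hx y hy
    rcases (cut_eq_empty hG).1 hy with rfl | rfl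
    · exact hK0 x hx
    · have h1 := commute_shiftMatrix_iff.1 hKflip (x - fun _ => 1) 0
      rw [sub_add_cancel, zero_add] at h1
      rw [h1]
      refine hK0 _ fun hx' => hx ?_
      have hcard : cut G (x - fun _ => 1) = cut G x := by
        ext e
        induction e with | _ i j => simp [mem_cut]
      rw [← hcard, hx']
  have hH : (isingHam G + ∑ S, ∑ s, VF S s -
      (z : ℂ) • (1 : Matrix (F2vec n) (F2vec n) ℂ)).IsHermitian := by
    refine (isingHam_isHermitian.add hV).sub ?_
    rw [Matrix.IsHermitian, Matrix.conjTranspose_smul, Matrix.conjTranspose_one]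
    simp
  refine ⟨z, hH, ?_⟩
  have hchar : (isingHam G + ∑ S, ∑ s, VF S s -
      (z : ℂ) • (1 : Matrix (F2vec n) (F2vec n) ℂ)).charpoly =
      (Polynomial.X - Polynomial.C (K 0 0 + K (fun _ => 1) 0)) *
        (Polynomial.X - Polynomial.C (K 0 0 - K (fun _ => 1) 0)) *
        (K.toSquareBlockProp fun x => ¬cut G x = ∅).charpoly := by
    rw [← charpoly_dress (G := G) c, dress_sub, dress_smul, dress_one, dress_isingHam_add,
      Matrix.charpoly_eq_mul_toSquareBlockProp K _ hKblock,
      charpoly_toSquareBlockProp_cut hG hn hKflip]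
  have hK00 : (K 0 0).re = 0 := by simp [hK, isingHam, cut_zero, hz]
  have hK10 : K (fun _ => 1) 0 = T (fun _ => 1) 0 := by simp [hK, isingHam, hne]
  have hre := (Complex.abs_re_le_norm (T (fun _ => 1) 0)).trans hflipEntry
  refine eigenvalues_of_charpoly_eq hH (Matrix.charpoly_monic _).ne_zero hchar ?_ ?_ ?_
  · rwa [Complex.add_re, hK00, zero_add, hK10]
  · rwa [Complex.sub_re, hK00, zero_sub, hK10, abs_neg]
  · intro t ht
    have h1 := le_re_of_isRoot_charpoly hG (by linarith) hzero
      (h.sum_norm_dressedPert_sub_le hG hΔ hκ.le hR hεκ hc) ht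
    simp only [Complex.sub_re, Complex.add_re, Complex.ofReal_re, ← hz] at h1
    linarith

end Stability

/-- Stability of the Ising model on an arbitrary graph under symmetric
perturbations with connected supports (spectral part).  For a connected graph `G` on
`n ≥ c₃` vertices of maximum degree at most `Δ_G`, the Ising Hamiltonian
`H₀ = Σ_{(i,j) ∈ E(G)} (I − ZᵢZⱼ)/2`, perturbed by `V = Σ_{S,s} V_{S,s}` with every `S`
connected, each `V_{S,s}` strongly supported and commuting with the global spin flip
`P(1ⁿ, 0)`, of `κ₁`-norm `ε ≤ min(ε₀, 1/(3c₁))`, has spectrum (up to an overall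
constant) in `[−ε_*, ε_*] ∪ [1/2 + ε_*, ∞)` with exactly `2` eigenvalues in the first
interval, where `ε_* = c₂·n·ε·e^{−κ₁·n/2}`. -/
theorem ising_stability_connected_symmetric_spectral
    (ΔG : ℕ) (hΔG : 2 ≤ ΔG) (κ₁ : ℝ) (hκ₁ : 0 < κ₁) :
    ∃ ε₀ c₁ c₂ c₃ : ℝ, 0 < ε₀ ∧ 0 < c₁ ∧ 0 < c₂ ∧ 0 < c₃ ∧
      ∀ (n : ℕ) (G : SimpleGraph (Fin n)) (_ : DecidableRel G.Adj),
        G.Connected →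
        (∀ i : Fin n, G.degree i ≤ ΔG) →
        (c₃ ≤ (n : ℝ)) →
        ∀ H₀ : Matrix (F2vec n) (F2vec n) ℂ,
        H₀ = (∑ e ∈ G.edgeFinset,
          ((2 : ℂ))⁻¹ • ((1 : Matrix (F2vec n) (F2vec n) ℂ) - pauli ((0 : F2vec n), isingVec e))) →
        ∀ (VF : Finset (Fin n) → Finset (Sym2 (Fin n)) → Matrix (F2vec n) (F2vec n) ℂ)
          (V : Matrix (F2vec n) (F2vec n) ℂ),
        V = (∑ S : Finset (Fin n), ∑ s : Finset (Sym2 (Fin n)), VF S s) →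
        V.IsHermitian →
        -- every S carrying a nonzero term is a connected subset of vertices of G
        (∀ S s, VF S s ≠ 0 → (G.induce (S : Set (Fin n))).Connected) →
        -- each term is strongly supported in S with syndrome s
        (∀ S s, VF S s ≠ 0 → IsingStronglySupported G (VF S s) S s) →
        -- each term commutes with the global spin flip, the all-ones X string
        (∀ S s, VF S s * pauli ((fun _ => 1 : F2vec n), (0 : F2vec n))
          = pauli ((fun _ => 1 : F2vec n), (0 : F2vec n)) * VF S s) →
        ∀ ε : ℝ, ε = isingKappaNorm VF κ₁ →
        ε ≤ min ε₀ (1 / (3 * c₁)) →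
        ∃ cstar : ℝ,
          ∃ hH : (H₀ + V - (cstar : ℂ) • (1 : Matrix (F2vec n) (F2vec n) ℂ)).IsHermitian,
            (∀ v : F2vec n, hH.eigenvalues v ∈
              Set.Icc (-(c₂ * n * ε * Real.exp (-(κ₁ * n / 2))))
                      (c₂ * n * ε * Real.exp (-(κ₁ * n / 2))) ∪
              Set.Ici (1 / 2 + c₂ * n * ε * Real.exp (-(κ₁ * n / 2)))) ∧
            (Finset.univ.filter fun v : F2vec n => hH.eigenvalues v ∈
              Set.Icc (-(c₂ * n * ε * Real.exp (-(κ₁ * n / 2))))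
                      (c₂ * n * ε * Real.exp (-(κ₁ * n / 2)))).card = 2 := by
  have hΔ0 : (0 : ℝ) < ΔG := by
    have : 0 < ΔG := by omega
    exact_mod_cast this
  refine ⟨min (1 / 20000) (min (κ₁ / (400 * ΔG)) (κ₁ / (16 * (200 * ΔG + 2)))), 1,
    200 * ΔG + 2, 1, by positivity, one_pos, by positivity, one_pos, ?_⟩
  intro n G _ hG hΔ hn H₀ hH₀ VF V hV hVherm hconn hsupp hflip ε hε hεle
  have hn0 : 0 < n := by exact_mod_cast one_pos.trans_le hn
  have hpres : IsSymmetricPresentation G VF (κ₁ / 2) ε := by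
    refine ⟨hsupp, fun S s h0 => ?_, fun S s y hy => ?_, fun i => ?_⟩
    · obtain ⟨⟨i, hi⟩⟩ := (hconn S s h0).nonempty
      exact ⟨i, hi⟩
    · by_cases h0 : VF S s = 0
      · rw [h0]
        exact Commute.zero_right _
      · refine (hsupp S s h0).commute_shiftMatrix (hconn S s h0) ?_ hy
        rw [← pauli_flip]
        exact (hflip S s).symm
    · have hκ : 2 * (κ₁ / 2) = κ₁ := by ring
      simp only [termWeight, hκ]
      rw [hε]
      exact le_ciSup (f := fun i : Fin n => ∑ S ∈ Finset.univ.filter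
        (fun S : Finset (Fin n) => i ∈ S), ∑ s : Finset (Sym2 (Fin n)),
          opNorm (VF S s) * Real.exp (κ₁ * S.card)) (Set.finite_range _).bddAbove i
  simp only [le_min_iff] at hεle
  obtain ⟨⟨hε1, hε2, hε3⟩, -⟩ := hεle
  rw [le_div_iff₀ (by positivity)] at hε2 hε3
  rw [ising_hamiltonian_eq_diagonal] at hH₀
  subst hH₀ hV
  have hmain := hpres.exists_shift hVherm hG hn0 hΔ (by positivity) hε1 (by linarith)
    (by linarith)
  rwa [div_mul_eq_mul_div] at hmain
end
end

section
/- Convergence of the Schrieffer–Wolff flow equations: Fix κ₁ > 0 and constants c' > 0, c'' ≥ 2, α > 0. Define κ_m := (κ₁/2)·(1 + 1/(1 + log m)) for integers m ≥ 1, δκ_m := κ_m − κ_{m+1}, and δκ̃_m := κ_m − κ_{2m}. Then there exist constants c_iter, ε₀ > 0 depending only on κ₁, c', c'', α, with c_iter·ε₀ ≤ 1/4, such that the following holds for every 0 < ε ≤ ε₀. Let (v_m)_{m≥1} and (ṽ_m)_{m≥1} be nonnegative real sequences with v₁ ≤ ε and ṽ₁ ≤ ε, define d_m := Σ_{m'=1}^{⌊m/2⌋}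 c''·exp(c'·(δκ̃_{m'})^{−α})·v_{m'} and d̃_m := 2·Σ_{m'=⌊m/2⌋+1}^{m−1} v_{m'}, and suppose that for every m ≥ 1: v_{m+1} ≤ (1/δκ_m)·d_m·ṽ_m + (1/δκ_m)·d̃_m·ṽ_m + (9/(κ_{m+1}·δκ_m))·ṽ_m·(3·v_m + (4/δκ_m)·ṽ_m·(d_m + d̃_m)), and ṽ_{m+1} ≤ d_m·ṽ_m + (1/δκ_m)·d̃_m·ṽ_m + (9/(κ_{m+1}·δκ_m))·ṽ_m·(3·v_m + (4/δκ_m)·ṽ_m·(d_m + d̃_m)). Then for every m ≥ 2: v_m ≤ (ε/δκ_{m−1})·(c_iter·ε)^{m−1}, ṽ_m ≤ ε·(c_iter·ε)^{m−1}, and d_m ≤ (2/3)·c_iter·ε; for every m ≥ 3: d̃_m ≤ (3ε/δκ_{m−2})·(c_iter·ε)^{⌊m/2⌋}; and ṽ_m ≤ δκ_m/3 for every m ≥ 1. -/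
section FlowLemmas

open Finset

/-- Tail of a geometric series with ratio at most `1/4`. -/
lemma sum_Icc_pow_pred_le {x : ℝ} (hx0 : 0 ≤ x) (hx : x ≤ 1 / 4) (a b : ℕ) :
    ∑ j ∈ Icc (a + 1) b, x ^ (j - 1) ≤ 4 / 3 * x ^ a := by
  have h1 : ∑ j ∈ Icc (a + 1) b, x ^ (j - 1) = ∑ i ∈ Ico a b, x ^ i := by
    have h := Finset.sum_Ico_add' (fun j => x ^ (j - 1)) a b 1
    simp only [Nat.add_sub_cancel] at h
    rw [h]
    rfl
  rw [h1]
  refine (geom_sum_Ico_le_of_lt_one hx0 (by linarith)).trans ?_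
  rw [div_le_iff₀ (by linarith)]
  nlinarith [pow_nonneg hx0 a]

set_option maxHeartbeats 1000000 in
/-- Geometric decay for flow inequalities with an abstract decreasing step `δ`, weights `A` and
scale `κ`, once the weighted sums are bounded by `S` and the inverse steps by `M`. -/
theorem flow_convergence_of_bounds {κ δ A : ℕ → ℝ} {k S M : ℝ} (hk : 0 < k)
    (hκ : ∀ m, 1 ≤ m → k ≤ κ m) (hδ : ∀ m, 1 ≤ m → 0 < δ m)
    (hanti : ∀ m n, 1 ≤ m → m ≤ n → δ n ≤ δ m) (hA : ∀ m, 0 ≤ A m)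
    (hS : ∀ N, ∑ j ∈ Icc 1 N, A j * (1 + 1 / δ j) * (1 / 4) ^ (j - 1) ≤ S)
    (hM : ∀ m, 2 ≤ m → (1 + 1 / δ m) ^ 2 * (1 / 4) ^ (m / 2 - 1) ≤ M) :
    ∃ c ε₀ : ℝ, 0 < c ∧ 0 < ε₀ ∧ c * ε₀ ≤ 1 / 4 ∧
      ∀ ε : ℝ, 0 < ε → ε ≤ ε₀ → ∀ v w D T : ℕ → ℝ,
        (∀ m, 1 ≤ m → 0 ≤ v m) → (∀ m, 1 ≤ m → 0 ≤ w m) → v 1 ≤ ε → w 1 ≤ ε →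
        (∀ m, D m = ∑ j ∈ Icc 1 (m / 2), A j * v j) →
        (∀ m, T m = 2 * ∑ j ∈ Icc (m / 2 + 1) (m - 1), v j) →
        (∀ m, 1 ≤ m → v (m + 1) ≤ (1 / δ m) * D m * w m + (1 / δ m) * T m * w m
          + (9 / (κ (m + 1) * δ m)) * w m * (3 * v m + (4 / δ m) * w m * (D m + T m))) →
        (∀ m, 1 ≤ m → w (m + 1) ≤ D m * w m + (1 / δ m) * T m * w m
          + (9 / (κ (m + 1) * δ m)) * w m * (3 * v m + (4 / δ m) * w m * (D m + T m))) →
        (∀ m, 2 ≤ m → v m ≤ (ε / δ (m - 1)) * (c * ε) ^ (m - 1) ∧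
            w m ≤ ε * (c * ε) ^ (m - 1) ∧ D m ≤ (2 / 3) * c * ε) ∧
          (∀ m, 3 ≤ m → T m ≤ (3 * ε / δ (m - 2)) * (c * ε) ^ (m / 2)) ∧
          (∀ m, 1 ≤ m → w m ≤ δ m / 3) := by
  have hS0 : 0 ≤ S := by simpa using hS 0
  have hG1 : 0 < 1 / δ 1 := one_div_pos.mpr (hδ 1 le_rfl)
  have hM1 : 1 ≤ M := by
    have h := hM 2 le_rfl
    have hG : 0 < 1 / δ 2 := one_div_pos.mpr (hδ 2 (by norm_num))
    norm_num only [Nat.div_self, Nat.sub_self, pow_zero, mul_one] at h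
    nlinarith
  set c : ℝ := 27 / k * (1 + 1 / δ 1) + 3 / 2 * S with hc_def
  have hc : 0 < c := by positivity
  have hL : 0 < 3 * M * (3 + 63 / k) := by positivity
  refine ⟨c, min (1 / (4 * c)) (1 / (3 * M * (3 + 63 / k))), hc, by positivity, ?_, ?_⟩
  · calc c * min (1 / (4 * c)) (1 / (3 * M * (3 + 63 / k))) ≤ c * (1 / (4 * c)) := by
          gcongr; exact min_le_left _ _
      _ = 1 / 4 := by field_simp
  intro ε hε hεle v w D T hv hw hv1 hw1 hD hT hvrec hwrec
  have hx : c * ε ≤ 1 / 4 := by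
    have h := hεle.trans (min_le_left _ _)
    rw [le_div_iff₀ (by positivity)] at h
    linarith
  have hεM : ε * M * (3 + 63 / k) ≤ 1 / 3 := by
    have h := hεle.trans (min_le_right _ _)
    rw [le_div_iff₀ hL] at h
    linarith
  have hεM9 : ε * M ≤ 1 / 9 := by
    have : 0 ≤ ε * M * (63 / k) := by positivity
    linarith
  have hcS : ε * S ≤ 2 / 3 * c * ε := by
    have : 0 ≤ 27 / k * (1 + 1 / δ 1) * ε := by positivity
    rw [hc_def]; linarith
  have hc1 : 27 / k * (1 + 1 / δ 1) * ε ≤ c * ε := by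
    have : 0 ≤ 3 / 2 * S * ε := by positivity
    rw [hc_def]; linarith
  clear_value c
  set x : ℝ := c * ε with hx_def
  have hx0 : 0 < x := by positivity
  have hcS' : ε * S ≤ 2 / 3 * x := by rw [hx_def]; linarith
  -- inverse steps times powers of `x`
  have hpow : ∀ m n, 2 ≤ m → m / 2 ≤ n → x ^ n ≤ x * (1 / 4) ^ (m / 2 - 1) := by
    intro m n hm hn
    calc x ^ n ≤ x ^ (m / 2 - 1 + 1) := by
          apply pow_le_pow_of_le_one hx0.le (by linarith); omega
      _ = x * x ^ (m / 2 - 1) := by ring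
      _ ≤ x * (1 / 4) ^ (m / 2 - 1) := by gcongr
  have hGM : ∀ m n, 2 ≤ m → m / 2 ≤ n → (1 + 1 / δ m) ^ 2 * x ^ n ≤ x * M := by
    intro m n hm hn
    calc (1 + 1 / δ m) ^ 2 * x ^ n ≤ (1 + 1 / δ m) ^ 2 * (x * (1 / 4) ^ (m / 2 - 1)) := by
          gcongr; exact hpow m n hm hn
      _ = x * ((1 + 1 / δ m) ^ 2 * (1 / 4) ^ (m / 2 - 1)) := by ring
      _ ≤ x * M := by gcongr; exact hM m hm
  -- bounds on the partial sums from bounds on the earlier terms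
  have hDbound : ∀ m, (∀ j, 2 ≤ j → j ≤ m / 2 → v j ≤ ε / δ (j - 1) * x ^ (j - 1)) →
      D m ≤ 2 / 3 * x := by
    intro m h
    have hterm : ∀ j ∈ Icc 1 (m / 2),
        A j * v j ≤ ε * (A j * (1 + 1 / δ j) * (1 / 4) ^ (j - 1)) := by
      intro j hj
      rw [mem_Icc] at hj
      have hδj := hδ j hj.1
      have hvj : v j ≤ ε * ((1 + 1 / δ j) * (1 / 4) ^ (j - 1)) := by
        rcases Nat.lt_or_ge 1 j with h2 | h2
        · have h3 := hδ (j - 1) (by omega)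
          calc v j ≤ ε / δ (j - 1) * x ^ (j - 1) := h j h2 hj.2
            _ = ε * (1 / δ (j - 1) * x ^ (j - 1)) := by ring
            _ ≤ ε * ((1 + 1 / δ j) * (1 / 4) ^ (j - 1)) := by
                have h4 : 1 / δ (j - 1) ≤ 1 / δ j :=
                  one_div_le_one_div_of_le hδj (hanti _ _ (by omega) (by omega))
                gcongr
                linarith
        · have : j = 1 := by omega
          subst this
          simp only [Nat.sub_self, pow_zero, mul_one]
          nlinarith
      calc A j * v j ≤ A j * (ε * ((1 + 1 / δ j) * (1 / 4) ^ (j - 1))) :=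
            mul_le_mul_of_nonneg_left hvj (hA j)
        _ = _ := by ring
    calc D m ≤ ε * ∑ j ∈ Icc 1 (m / 2), A j * (1 + 1 / δ j) * (1 / 4) ^ (j - 1) := by
          rw [hD, mul_sum]; exact sum_le_sum hterm
      _ ≤ ε * S := by gcongr; exact hS _
      _ ≤ _ := hcS'
  have hTbound : ∀ m, 3 ≤ m →
      (∀ j, 2 ≤ j → j ≤ m - 1 → v j ≤ ε / δ (j - 1) * x ^ (j - 1)) →
      T m ≤ 3 * ε / δ (m - 2) * x ^ (m / 2) := by
    intro m hm h
    have hδm := hδ (m - 2) (by omega)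
    have hterm : ∀ j ∈ Icc (m / 2 + 1) (m - 1), v j ≤ ε / δ (m - 2) * x ^ (j - 1) := by
      intro j hj
      rw [mem_Icc] at hj
      refine (h j (by omega) hj.2).trans ?_
      have h4 := hanti (j - 1) (m - 2) (by omega) (by omega)
      gcongr
    have hsum := sum_Icc_pow_pred_le hx0.le hx (m / 2) (m - 1)
    calc T m ≤ 2 * (ε / δ (m - 2) * ∑ j ∈ Icc (m / 2 + 1) (m - 1), x ^ (j - 1)) := by
          have := sum_le_sum hterm
          rw [← mul_sum] at this
          rw [hT]
          linarith
      _ ≤ 2 * (ε / δ (m - 2) * (4 / 3 * x ^ (m / 2))) := by gcongr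
      _ = 8 / 3 * (ε / δ (m - 2) * x ^ (m / 2)) := by ring
      _ ≤ 3 * (ε / δ (m - 2) * x ^ (m / 2)) := by gcongr; norm_num
      _ = _ := by ring
  have hD0 : ∀ m, 0 ≤ D m := by
    intro m; rw [hD]
    exact sum_nonneg fun j hj => mul_nonneg (hA j) (hv j (mem_Icc.mp hj).1)
  have hT0 : ∀ m, 0 ≤ T m := by
    intro m; rw [hT]
    exact mul_nonneg (by norm_num)
      (sum_nonneg fun j hj => hv j (by have := (mem_Icc.mp hj).1; omega))
  have hmain : ∀ m, 1 ≤ m → (2 ≤ m → v m ≤ ε / δ (m - 1) * x ^ (m - 1)) ∧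
      w m ≤ ε * x ^ (m - 1) := by
    intro m
    induction m using Nat.strong_induction_on with
    | _ n ih =>
      intro hn
      rcases Nat.lt_or_ge n 2 with hn2 | hn2
      · have : n = 1 := by omega
        subst this
        exact ⟨fun h => by omega, by simpa using hw1⟩
      obtain ⟨m, rfl⟩ : ∃ m, n = m + 1 := ⟨n - 1, by omega⟩
      have hm : 1 ≤ m := by omega
      have hδm := hδ m hm
      have hκm := hκ (m + 1) (by omega)
      have hκ0 : 0 < κ (m + 1) := hk.trans_le hκm
      have hvm := hv m hm
      have hwm := hw m hm
      have hwle := (ih m (by omega) hm).2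
      have hvr := hvrec m hm
      have hwr := hwrec m hm
      simp only [Nat.add_sub_cancel]
      have h9 : 9 / κ (m + 1) ≤ 9 / k := by gcongr
      set G := 1 / δ m with hG
      have hG0 : 0 < G := by positivity
      set E := 9 / k * (3 * v m + 4 * G * w m * (D m + T m)) with hE
      have hDm := hD0 m
      have hTm := hT0 m
      have hE0 : 0 ≤ E := by positivity
      have hrest : (9 / (κ (m + 1) * δ m)) * w m * (3 * v m + (4 / δ m) * w m * (D m + T m))
          ≤ G * w m * E := by
        have e : (9 / (κ (m + 1) * δ m)) * w m * (3 * v m + (4 / δ m) * w m * (D m + T m))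
          = G * w m * (9 / κ (m + 1) * (3 * v m + 4 * G * w m * (D m + T m))) := by
          rw [hG]; field_simp
        rw [e, hE]
        gcongr
      have key : ∀ R : ℝ, R ≤ x → R * w m ≤ ε * x ^ m := by
        intro R hR
        calc R * w m ≤ x * (ε * x ^ (m - 1)) := by gcongr
          _ = ε * x ^ (m - 1 + 1) := by ring
          _ = ε * x ^ m := by rw [Nat.sub_add_cancel hm]
      have hvr' : v (m + 1) ≤ G * ((D m + T m + E) * w m) := by linarith
      have hwr' : w (m + 1) ≤ (D m + G * T m + G * E) * w m := by linarith
      suffices hR : D m + T m + E ≤ x ∧ D m + G * T m + G * E ≤ x by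
        refine ⟨fun _ => hvr'.trans ?_, hwr'.trans (key _ hR.2)⟩
        calc G * ((D m + T m + E) * w m) ≤ G * (ε * x ^ m) :=
              mul_le_mul_of_nonneg_left (key _ hR.1) hG0.le
          _ = _ := by rw [hG]; ring
      rcases Nat.lt_or_ge m 2 with hm2 | hm2
      · have : m = 1 := by omega
        subst this
        have hD1 : D 1 = 0 := by rw [hD]; simp
        have hT1 : T 1 = 0 := by rw [hT]; simp
        have hE1 : E ≤ 27 / k * ε := by
          rw [hE, hD1, hT1]
          calc 9 / k * (3 * v 1 + 4 * G * w 1 * (0 + 0)) = 27 / k * v 1 := by ring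
            _ ≤ 27 / k * ε := by gcongr
        have hGE : G * E ≤ G * (27 / k * ε) := by gcongr
        have hp : 0 ≤ 27 / k * ε := by positivity
        have hGp : 0 ≤ G * (27 / k * ε) := by positivity
        have e : 27 / k * (1 + G) * ε = 27 / k * ε + G * (27 / k * ε) := by ring
        rw [hD1, hT1]
        constructor <;> linarith
      · have hDle : D m ≤ 2 / 3 * x :=
          hDbound m fun j hj hjm => (ih j (by omega) (by omega)).1 hj
        have hG2 : ∀ n, m / 2 ≤ n → G ^ 2 * x ^ n ≤ x * M ∧ G * x ^ n ≤ x * M := by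
          intro n hn
          have h := hGM m n hm2 hn
          have hp : 0 ≤ x ^ n := by positivity
          have e : (1 + G) ^ 2 * x ^ n = x ^ n + 2 * (G * x ^ n) + G ^ 2 * x ^ n := by ring
          rw [e] at h
          have h1 : 0 ≤ G * x ^ n := by positivity
          have h2 : 0 ≤ G ^ 2 * x ^ n := by positivity
          constructor <;> linarith
        have hTG : T m ≤ 3 * ε * (G * x ^ (m / 2)) := by
          rcases Nat.lt_or_ge m 3 with h3 | h3
          · have : m = 2 := by omega
            have : T m = 0 := by rw [hT, this]; simp
            rw [this]; positivity
          · have hδm2 := hδ (m - 2) (by omega)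
            have h4 : 1 / δ (m - 2) ≤ G :=
              one_div_le_one_div_of_le hδm (hanti _ _ (by omega) (by omega))
            calc T m ≤ 3 * ε / δ (m - 2) * x ^ (m / 2) :=
                  hTbound m h3 fun j hj hjm => (ih j (by omega) (by omega)).1 hj
              _ = 3 * ε * (1 / δ (m - 2) * x ^ (m / 2)) := by ring
              _ ≤ _ := by gcongr
        have hvG : v m ≤ ε * (G * x ^ (m - 1)) := by
          have hδm2 := hδ (m - 1) (by omega)
          have h4 : 1 / δ (m - 1) ≤ G :=
            one_div_le_one_div_of_le hδm (hanti _ _ (by omega) (by omega))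
          calc v m ≤ ε / δ (m - 1) * x ^ (m - 1) := (ih m (by omega) hm).1 hm2
            _ = ε * (1 / δ (m - 1) * x ^ (m - 1)) := by ring
            _ ≤ _ := by gcongr
        obtain ⟨ha2, ha1⟩ := hG2 (m / 2) le_rfl
        obtain ⟨hb2, hb1⟩ := hG2 (m - 1) (by omega)
        have hT1 : T m ≤ 3 * (ε * M) * x := by
          calc T m ≤ 3 * ε * (x * M) := hTG.trans (by gcongr)
            _ = _ := by ring
        have hT2 : G * T m ≤ 3 * (ε * M) * x := by
          calc G * T m ≤ G * (3 * ε * (G * x ^ (m / 2))) := by gcongr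
            _ = 3 * ε * (G ^ 2 * x ^ (m / 2)) := by ring
            _ ≤ 3 * ε * (x * M) := by gcongr
            _ = _ := by ring
        have hDT : D m + T m ≤ 1 := by
          have := mul_le_mul_of_nonneg_right hεM9 hx0.le
          linarith
        have hEle : E ≤ 9 / k * (7 * ε * (G * x ^ (m - 1))) := by
          rw [hE]
          have : 4 * G * w m * (D m + T m) ≤ 4 * G * (ε * x ^ (m - 1)) * 1 := by gcongr
          gcongr
          linarith
        have hE1 : E ≤ ε * M * (63 / k) * x := by
          calc E ≤ 9 / k * (7 * ε * (x * M)) := hEle.trans (by gcongr)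
            _ = _ := by ring
        have hE2 : G * E ≤ ε * M * (63 / k) * x := by
          calc G * E ≤ G * (9 / k * (7 * ε * (G * x ^ (m - 1)))) := by gcongr
            _ = 9 / k * (7 * ε * (G ^ 2 * x ^ (m - 1))) := by ring
            _ ≤ 9 / k * (7 * ε * (x * M)) := by gcongr
            _ = _ := by ring
        have hfin := mul_le_mul_of_nonneg_right hεM hx0.le
        constructor <;> linarith
  refine ⟨fun m hm => ⟨(hmain m (by omega)).1 hm, (hmain m (by omega)).2, ?_⟩,
    fun m hm => hTbound m hm fun j hj _ => (hmain j (by omega)).1 hj, fun m hm => ?_⟩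
  · have := hDbound m fun j hj _ => (hmain j (by omega)).1 hj
    rw [hx_def] at this
    linarith
  · have hδm := hδ m hm
    rcases Nat.lt_or_ge m 2 with hm2 | hm2
    · have : m = 1 := by omega
      subst this
      have h2 := hδ 2 (by norm_num)
      have h := hM 2 le_rfl
      have h4 := hanti 1 2 le_rfl (by norm_num)
      have hG : 0 < 1 / δ 2 := one_div_pos.mpr h2
      have hG2 : 1 / δ 2 ≤ M := by
        norm_num only [Nat.div_self, Nat.sub_self, pow_zero, mul_one] at h
        nlinarith
      rw [div_le_iff₀ h2] at hG2
      nlinarith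
    · have h := hGM m (m - 1) hm2 (by omega)
      have hp : 0 < x ^ (m - 1) := by positivity
      have hG : 0 < 1 / δ m := one_div_pos.mpr hδm
      have h1 : 1 / δ m * x ^ (m - 1) ≤ x * M := by nlinarith [mul_pos hG hp]
      have h2 : x ^ (m - 1) ≤ x * M * δ m := by
        have := mul_le_mul_of_nonneg_right h1 hδm.le
        have e : 1 / δ m * x ^ (m - 1) * δ m = x ^ (m - 1) := by field_simp
        rwa [e] at this
      calc w m ≤ ε * x ^ (m - 1) := (hmain m hm).2
        _ ≤ ε * (x * M * δ m) := by gcongr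
        _ = ε * M * (x * δ m) := by ring
        _ ≤ 1 / 9 * (1 * δ m) := by gcongr; linarith
        _ ≤ δ m / 3 := by linarith

/-- The scale `(K/2)(1 + 1/(1 + log m))`. -/
noncomputable def kappaSeq (K : ℝ) (m : ℕ) : ℝ := K / 2 * (1 + 1 / (1 + Real.log m))

lemma half_le_kappaSeq {K : ℝ} (hK : 0 < K) (m : ℕ) : K / 2 ≤ kappaSeq K m := by
  have := Real.log_natCast_nonneg m
  have h : 0 ≤ 1 / (1 + Real.log m) := by positivity
  unfold kappaSeq
  nlinarith

lemma kappaSeq_sub_kappaSeq (K : ℝ) (m n : ℕ) :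
    kappaSeq K m - kappaSeq K n =
      K / 2 * ((Real.log n - Real.log m) / ((1 + Real.log m) * (1 + Real.log n))) := by
  have := Real.log_natCast_nonneg m
  have := Real.log_natCast_nonneg n
  have h1 : 1 + Real.log m ≠ 0 := by positivity
  have h2 : 1 + Real.log n ≠ 0 := by positivity
  unfold kappaSeq
  field_simp
  ring

lemma one_add_log_natCast_le {m : ℕ} (hm : 1 ≤ m) : 1 + Real.log m ≤ m := by
  have h : (0 : ℝ) < m := by exact_mod_cast hm
  linarith [Real.log_le_sub_one_of_pos h]

lemma inv_succ_le_log_succ_sub_log {m : ℕ} (hm : 1 ≤ m) :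
    1 / ((m : ℝ) + 1) ≤ Real.log ((m + 1 : ℕ) : ℝ) - Real.log m := by
  have h : (0 : ℝ) < m := by exact_mod_cast hm
  push_cast
  have h1 := Real.log_le_sub_one_of_pos (x := (m : ℝ) / (m + 1)) (by positivity)
  rw [Real.log_div h.ne' (by positivity)] at h1
  have e : (m : ℝ) / (m + 1) - 1 = -(1 / ((m : ℝ) + 1)) := by field_simp; ring
  linarith

lemma kappaSeq_step_lower {K : ℝ} (hK : 0 < K) {m : ℕ} (hm : 1 ≤ m) :
    K / 2 / ((m : ℝ) + 1) ^ 3 ≤ kappaSeq K m - kappaSeq K (m + 1) := by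
  have h : (0 : ℝ) < m := by exact_mod_cast hm
  rw [kappaSeq_sub_kappaSeq]
  have h0 := Real.log_natCast_nonneg m
  have h0' := Real.log_natCast_nonneg (m + 1)
  have h1 := one_add_log_natCast_le hm
  have h2 := one_add_log_natCast_le (m := m + 1) (by omega)
  have h3 := inv_succ_le_log_succ_sub_log hm
  push_cast at h2 h3 h0' ⊢
  calc K / 2 / ((m : ℝ) + 1) ^ 3
      = K / 2 * ((1 / ((m : ℝ) + 1)) / (((m : ℝ) + 1) * ((m : ℝ) + 1))) := by field_simp
    _ ≤ _ := by
      have h4 : 0 ≤ Real.log (m + 1) - Real.log m := le_trans (by positivity) h3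
      gcongr ?_ * (?_ / (?_ * ?_))
      linarith

lemma kappaSeq_step_pos {K : ℝ} (hK : 0 < K) {m : ℕ} (hm : 1 ≤ m) :
    0 < kappaSeq K m - kappaSeq K (m + 1) :=
  lt_of_lt_of_le (by positivity) (kappaSeq_step_lower hK hm)

lemma kappaSeq_step_antitone {K : ℝ} (hK : 0 < K) {m n : ℕ} (hm : 1 ≤ m) (hmn : m ≤ n) :
    kappaSeq K n - kappaSeq K (n + 1) ≤ kappaSeq K m - kappaSeq K (m + 1) := by
  have h : (0 : ℝ) < m := by exact_mod_cast hm
  have hn : (0 : ℝ) < n := by exact_mod_cast hm.trans hmn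
  have hmn' : (m : ℝ) ≤ n := by exact_mod_cast hmn
  rw [kappaSeq_sub_kappaSeq, kappaSeq_sub_kappaSeq]
  have h0 := Real.log_natCast_nonneg m
  have h0' := Real.log_natCast_nonneg (m + 1)
  have h3 := inv_succ_le_log_succ_sub_log hm
  have h4 : Real.log ((n + 1 : ℕ) : ℝ) - Real.log n ≤
      Real.log ((m + 1 : ℕ) : ℝ) - Real.log m := by
    push_cast
    rw [← Real.log_div (by positivity) hn.ne', ← Real.log_div (by positivity) h.ne']
    apply Real.log_le_log (by positivity)
    rw [div_le_div_iff₀ hn h]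
    nlinarith
  have h5 : Real.log m ≤ Real.log n := Real.log_le_log h hmn'
  have h6 : Real.log ((m + 1 : ℕ) : ℝ) ≤ Real.log ((n + 1 : ℕ) : ℝ) :=
    Real.log_le_log (by positivity) (by push_cast; linarith)
  have h7 : 0 ≤ Real.log ((m + 1 : ℕ) : ℝ) - Real.log m := le_trans (by positivity) h3
  gcongr

lemma one_add_inv_kappaSeq_step_le {K : ℝ} (hK : 0 < K) {m : ℕ} (hm : 1 ≤ m) :
    1 + 1 / (kappaSeq K m - kappaSeq K (m + 1)) ≤ (1 + 2 / K) * ((m : ℝ) + 1) ^ 3 := by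
  have h := one_div_le_one_div_of_le (by positivity) (kappaSeq_step_lower hK hm)
  have e : 1 / (K / 2 / ((m : ℝ) + 1) ^ 3) = 2 / K * ((m : ℝ) + 1) ^ 3 := by field_simp
  have h1 : (1 : ℝ) ≤ ((m : ℝ) + 1) ^ 3 := one_le_pow₀ (by linarith [m.cast_nonneg (α := ℝ)])
  linarith

/-- The doubling step of `kappaSeq` is bounded below by any small negative power of `m`. -/
lemma exists_kappaSeq_double_lower {K s : ℝ} (hK : 0 < K) (hs : 0 < s) :
    ∃ C : ℝ, 0 < C ∧ ∀ m : ℕ, 1 ≤ m →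
      C * (m : ℝ) ^ (-(2 * s)) ≤ kappaSeq K m - kappaSeq K (2 * m) := by
  have hl2 : 0 < Real.log 2 := Real.log_pos (by norm_num)
  set B : ℝ := (2 * Real.exp 1) ^ s / s with hB
  have hB0 : 0 < B := by positivity
  refine ⟨K / 2 * (Real.log 2 / (B * B)), by positivity, fun m hm => ?_⟩
  have h : (0 : ℝ) < m := by exact_mod_cast hm
  rw [kappaSeq_sub_kappaSeq]
  have h0 := Real.log_natCast_nonneg m
  have hlog : Real.log ((2 * m : ℕ) : ℝ) = Real.log 2 + Real.log m := by
    push_cast; rw [Real.log_mul (by norm_num) h.ne']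
  have hb : 1 + Real.log ((2 * m : ℕ) : ℝ) ≤ B * (m : ℝ) ^ s := by
    have h1 := Real.log_le_rpow_div (x := 2 * Real.exp 1 * m) (by positivity) hs
    rw [Real.log_mul (by positivity) h.ne', Real.log_mul (by norm_num) (by positivity),
      Real.log_exp, Real.mul_rpow (by positivity) h.le] at h1
    rw [hlog, hB]
    calc _ = Real.log 2 + 1 + Real.log m := by ring
      _ ≤ _ := h1
      _ = _ := by ring
  have hb' : 1 + Real.log m ≤ B * (m : ℝ) ^ s := by rw [hlog] at hb; linarith
  have hnum : Real.log ((2 * m : ℕ) : ℝ) - Real.log m = Real.log 2 := by rw [hlog]; ring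
  have hpos : 0 < 1 + Real.log ((2 * m : ℕ) : ℝ) := by rw [hlog]; positivity
  have hms : (m : ℝ) ^ (-(2 * s)) = 1 / ((m : ℝ) ^ s * (m : ℝ) ^ s) := by
    rw [Real.rpow_neg h.le, ← Real.rpow_add h, one_div]; ring_nf
  rw [hnum, hms]
  have hmp : 0 < (m : ℝ) ^ s := by positivity
  calc K / 2 * (Real.log 2 / (B * B)) * (1 / ((m : ℝ) ^ s * (m : ℝ) ^ s))
      = K / 2 * (Real.log 2 / ((B * (m : ℝ) ^ s) * (B * (m : ℝ) ^ s))) := by field_simp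
    _ ≤ _ := by gcongr

/-- The weights `exp (c (κ_m - κ_{2m})^{-α})` grow at most like `2 ^ m`. -/
lemma exists_exp_kappaSeq_double_le {K c α : ℝ} (hK : 0 < K) (hc : 0 < c) (hα : 0 < α) :
    ∃ B : ℝ, 0 < B ∧ ∀ m : ℕ, 1 ≤ m →
      Real.exp (c * (kappaSeq K m - kappaSeq K (2 * m)) ^ (-α)) ≤ B * 2 ^ m := by
  obtain ⟨C, hC, h⟩ := exists_kappaSeq_double_lower hK (s := 1 / (4 * α)) (by positivity)
  set a := c * C ^ (-α) with ha
  refine ⟨Real.exp (a ^ 2 / 2), by positivity, fun m hm => ?_⟩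
  have hm0 : (0 : ℝ) < m := by exact_mod_cast hm
  have h1 : (kappaSeq K m - kappaSeq K (2 * m)) ^ (-α) ≤ C ^ (-α) * √m := by
    refine (Real.rpow_le_rpow_of_nonpos (by positivity) (h m hm) (by linarith)).trans_eq ?_
    rw [Real.mul_rpow hC.le (by positivity), ← Real.rpow_mul hm0.le, Real.sqrt_eq_rpow]
    congr 2
    field_simp
    norm_num
  have h2 : c * (kappaSeq K m - kappaSeq K (2 * m)) ^ (-α) ≤ a ^ 2 / 2 + m * (1 / 2) := by
    have h3 := mul_le_mul_of_nonneg_left h1 hc.le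
    have h4 := Real.sq_sqrt hm0.le
    nlinarith [sq_nonneg (a - √m)]
  have h5 : Real.exp (1 / 2) ≤ 2 := by
    have h6 : Real.exp (1 / 2) ^ 2 = Real.exp 1 := by rw [← Real.exp_nat_mul]; norm_num
    have := Real.exp_one_lt_d9
    nlinarith [Real.exp_pos (1 / 2)]
  calc _ ≤ Real.exp (a ^ 2 / 2 + m * (1 / 2)) := Real.exp_le_exp.mpr h2
    _ = Real.exp (a ^ 2 / 2) * Real.exp (1 / 2) ^ m := by rw [Real.exp_add, Real.exp_nat_mul]
    _ ≤ _ := by gcongr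

lemma summable_succ_pow_mul_half_pow (k : ℕ) :
    Summable fun m : ℕ => ((m : ℝ) + 1) ^ k * (1 / 2) ^ m := by
  have h := summable_pow_mul_geometric_of_norm_lt_one (R := ℝ) k (r := 1 / 2) (by norm_num)
  have h' := ((summable_nat_add_iff 1).mpr h).mul_left 2
  refine h'.congr fun m => ?_
  push_cast
  ring

/-- Partial sums of weights of growth `2 ^ m` against the inverse steps and `4 ^ (-m)`. -/
lemma exists_weighted_sum_kappaSeq_le {K B : ℝ} (hK : 0 < K) {A : ℕ → ℝ}
    (hB : 0 < B) (hAB : ∀ m, 1 ≤ m → A m ≤ B * 2 ^ m) :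
    ∃ S : ℝ, ∀ N : ℕ, ∑ j ∈ Icc 1 N,
      A j * (1 + 1 / (kappaSeq K j - kappaSeq K (j + 1))) * (1 / 4) ^ (j - 1) ≤ S := by
  have hsum := (summable_succ_pow_mul_half_pow 3).mul_left (4 * B * (1 + 2 / K))
  refine ⟨∑' m : ℕ, 4 * B * (1 + 2 / K) * (((m : ℝ) + 1) ^ 3 * (1 / 2) ^ m), fun N => ?_⟩
  refine le_trans (sum_le_sum fun j hj => ?_)
    (hsum.sum_le_tsum (Icc 1 N) fun m _ => by positivity)
  have hj1 := (mem_Icc.mp hj).1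
  have hstep := kappaSeq_step_pos hK hj1
  have hq : (1 / 4 : ℝ) ^ (j - 1) = 4 * ((1 / 2) ^ j * (1 / 2) ^ j) := by
    obtain ⟨i, rfl⟩ : ∃ i, j = i + 1 := ⟨j - 1, by omega⟩
    rw [Nat.add_sub_cancel, ← mul_pow, pow_succ]
    norm_num
    ring
  have h2 : (2 : ℝ) ^ j * (1 / 2) ^ j = 1 := by rw [← mul_pow]; norm_num
  calc A j * (1 + 1 / (kappaSeq K j - kappaSeq K (j + 1))) * (1 / 4) ^ (j - 1)
      ≤ B * 2 ^ j * ((1 + 2 / K) * ((j : ℝ) + 1) ^ 3) * (1 / 4) ^ (j - 1) := by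
        gcongr
        · exact hAB j hj1
        · exact one_add_inv_kappaSeq_step_le hK hj1
    _ = 4 * B * (1 + 2 / K) * (((j : ℝ) + 1) ^ 3 * (1 / 2) ^ j) * (2 ^ j * (1 / 2) ^ j) := by
        rw [hq]; ring
    _ = _ := by rw [h2, mul_one]

lemma exists_sq_inv_kappaSeq_step_le {K : ℝ} (hK : 0 < K) :
    ∃ M : ℝ, ∀ m : ℕ, 2 ≤ m →
      (1 + 1 / (kappaSeq K m - kappaSeq K (m + 1))) ^ 2 * (1 / 4) ^ (m / 2 - 1) ≤ M := by
  have hsum := (summable_succ_pow_mul_half_pow 6).mul_left (8 * (1 + 2 / K) ^ 2)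
  refine ⟨∑' m : ℕ, 8 * (1 + 2 / K) ^ 2 * (((m : ℝ) + 1) ^ 6 * (1 / 2) ^ m), fun m hm => ?_⟩
  refine le_trans ?_ (hsum.le_tsum m fun m _ => by positivity)
  have hstep := kappaSeq_step_pos hK (m := m) (by omega)
  have hq : (1 / 4 : ℝ) ^ (m / 2 - 1) ≤ 8 * (1 / 2) ^ m := by
    have e : (1 / 4 : ℝ) ^ (m / 2 - 1) = (1 / 2) ^ (2 * (m / 2 - 1)) := by
      rw [pow_mul]; norm_num
    rcases Nat.lt_or_ge m 3 with h | h
    · have : m = 2 := by omega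
      subst this; norm_num
    · rw [e]
      calc (1 / 2 : ℝ) ^ (2 * (m / 2 - 1)) ≤ (1 / 2) ^ (m - 3) :=
            pow_le_pow_of_le_one (by norm_num) (by norm_num) (by omega)
        _ = 8 * (1 / 2) ^ (m - 3 + 3) := by rw [pow_add]; norm_num; ring
        _ = 8 * (1 / 2) ^ m := by rw [Nat.sub_add_cancel h]
  calc _ ≤ ((1 + 2 / K) * ((m : ℝ) + 1) ^ 3) ^ 2 * (8 * (1 / 2) ^ m) := by
        gcongr
        exact one_add_inv_kappaSeq_step_le hK (by omega)
    _ = _ := by ring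

end FlowLemmas

/-- Convergence of the Schrieffer–Wolff flow equations.  With
`κ_m = (κ₁/2)(1 + 1/(1+log m))`, `δκ_m = κ_m − κ_{m+1}`, `δκ̃_m = κ_m − κ_{2m}`, there
exist constants `c_iter, ε₀ > 0` depending only on `κ₁, c', c'', α` with
`c_iter·ε₀ ≤ 1/4` such that any nonnegative sequences `v, ṽ` with `v₁, ṽ₁ ≤ ε ≤ ε₀`
satisfying the flow inequalities obey the stated decay bounds. -/
theorem schrieffer_wolff_flow_convergence
    (κ₁ c' c'' α : ℝ) (hκ₁ : 0 < κ₁) (hc' : 0 < c') (hc'' : 2 ≤ c'') (hα : 0 < α) :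
    ∃ citer ε₀ : ℝ, 0 < citer ∧ 0 < ε₀ ∧ citer * ε₀ ≤ 1 / 4 ∧
      ∀ ε : ℝ, 0 < ε → ε ≤ ε₀ →
      ∀ v vt : ℕ → ℝ,
        (∀ m : ℕ, 1 ≤ m → 0 ≤ v m) →
        (∀ m : ℕ, 1 ≤ m → 0 ≤ vt m) →
        v 1 ≤ ε → vt 1 ≤ ε →
        (let kap : ℕ → ℝ := fun m => κ₁ / 2 * (1 + 1 / (1 + Real.log m));
         let dk : ℕ → ℝ := fun m => kap m - kap (m + 1);
         let dkt : ℕ → ℝ := fun m => kap m - kap (2 * m);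
         let D : ℕ → ℝ := fun m =>
           ∑ m' ∈ Finset.Icc 1 (m / 2), c'' * Real.exp (c' * dkt m' ^ (-α)) * v m';
         let Dt : ℕ → ℝ := fun m => 2 * ∑ m' ∈ Finset.Icc (m / 2 + 1) (m - 1), v m';
         (∀ m : ℕ, 1 ≤ m →
            v (m + 1) ≤ (1 / dk m) * D m * vt m + (1 / dk m) * Dt m * vt m
              + (9 / (kap (m + 1) * dk m)) * vt m
                  * (3 * v m + (4 / dk m) * vt m * (D m + Dt m))) →
         (∀ m : ℕ, 1 ≤ m →
            vt (m + 1) ≤ D m * vt m + (1 / dk m) * Dt m * vt m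
              + (9 / (kap (m + 1) * dk m)) * vt m
                  * (3 * v m + (4 / dk m) * vt m * (D m + Dt m))) →
         ((∀ m : ℕ, 2 ≤ m →
             v m ≤ (ε / dk (m - 1)) * (citer * ε) ^ (m - 1) ∧
             vt m ≤ ε * (citer * ε) ^ (m - 1) ∧
             D m ≤ (2 / 3) * citer * ε) ∧
          (∀ m : ℕ, 3 ≤ m → Dt m ≤ (3 * ε / dk (m - 2)) * (citer * ε) ^ (m / 2)) ∧
          (∀ m : ℕ, 1 ≤ m → vt m ≤ dk m / 3))) := by
  obtain ⟨B, hB, hexp⟩ := exists_exp_kappaSeq_double_le hκ₁ hc' hα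
  have hc0 : 0 < c'' := by linarith
  obtain ⟨S, hS⟩ := exists_weighted_sum_kappaSeq_le hκ₁ (B := c'' * B)
    (A := fun j => c'' * Real.exp (c' * (kappaSeq κ₁ j - kappaSeq κ₁ (2 * j)) ^ (-α)))
    (by positivity) fun m hm => by
      rw [mul_assoc]
      exact mul_le_mul_of_nonneg_left (hexp m hm) hc0.le
  obtain ⟨M, hM⟩ := exists_sq_inv_kappaSeq_step_le hκ₁
  obtain ⟨c, ε₀, hc, hε₀, hcε, h⟩ := flow_convergence_of_bounds (κ := kappaSeq κ₁)
    (δ := fun m => kappaSeq κ₁ m - kappaSeq κ₁ (m + 1)) (half_pos hκ₁)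
    (fun m _ => half_le_kappaSeq hκ₁ m) (fun m hm => kappaSeq_step_pos hκ₁ hm)
    (fun m n hm hmn => kappaSeq_step_antitone hκ₁ hm hmn) (fun m => by positivity) hS hM
  refine ⟨c, ε₀, hc, hε₀, hcε, ?_⟩
  intro ε hε hεle v vt hv hvt hv1 hvt1 kap dk dkt D Dt hvrec hvtrec
  exact h ε hε hεle v vt D Dt hv hvt hv1 hvt1 (fun m => rfl) (fun m => rfl) hvrec hvtrec
end
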